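/- arXiv:2411.12311 — 7 statements merged into one kernel-verified Lean document; each statement's English description precedes it below -/
import Mathlib

section
/- Let (𝔤,⟨·,·⟩) be a metric Lie algebra of dimension n ≥ 2 containing an abelian ideal 𝔞 of codimension 1. Let e be a unit vector orthogonal to 𝔞, Q = ad(e)|_𝔞 ∈ End(𝔞), Qᵗ its adjoint with respect to ⟨·,·⟩, and S = (1/2)(Q+Qᵗ). Then (𝔤,⟨·,·⟩) is weakly Einstein if and only if Q is normal (Q∘Qᵗ = Qᵗ∘Q) and S² = a²·id_𝔞 for some a ∈ ℝ. -/
open Module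
open scoped InnerProductSpace BigOperators

noncomputable section

variable {V : Type*} [NormedAddCommGroup V] [InnerProductSpace ℝ V]

/-- `br` is a Lie bracket: bilinear (in the first slot; bilinearity in the second slot
follows from antisymmetry), antisymmetric and satisfying the Jacobi identity. -/
structure IsLieBracket (br : V → V → V) : Prop where
  add_left : ∀ X Y Z : V, br (X + Y) Z = br X Z + br Y Z
  smul_left : ∀ (c : ℝ) (X Y : V), br (c • X) Y = c • br X Y
  antisymm : ∀ X Y : V, br X Y = - br Y X
  jacobi : ∀ X Y Z : V, br (br X Y) Z + br (br Y Z) X + br (br Z X) Y = 0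

/-- `nab` is the Levi-Civita product of the metric Lie algebra `(V, ⟪·,·⟫, br)`,
determined by the Koszul formula. -/
def IsLeviCivita (br nab : V → V → V) : Prop :=
  ∀ U W Z : V, ⟪nab U W, Z⟫_ℝ =
    (1 / 2) * (⟪br U W, Z⟫_ℝ - ⟪br W Z, U⟫_ℝ + ⟪br Z U, W⟫_ℝ)

/-- The curvature operator `R(X,Y)Z = ∇_X ∇_Y Z − ∇_Y ∇_X Z − ∇_{[X,Y]} Z`. -/
def curvOp (br nab : V → V → V) (X Y Z : V) : V :=
  nab X (nab Y Z) - nab Y (nab X Z) - nab (br X Y) Z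

/-- The curvature tensor `R(X,Y,Z,W) = ⟨R(X,Y)Z, W⟩`. -/
def curv (br nab : V → V → V) (X Y Z W : V) : ℝ :=
  ⟪curvOp br nab X Y Z, W⟫_ℝ

/-- `Ř(X,Y) = Σ_{a,b,c} R(X,e_a,e_b,e_c) R(Y,e_a,e_b,e_c)` relative to an
orthonormal basis `e`. -/
def checkR (br nab : V → V → V) {ι : Type*} [Fintype ι]
    (e : OrthonormalBasis ι ℝ V) (X Y : V) : ℝ :=
  ∑ a, ∑ b, ∑ c,
    curv br nab X (e a) (e b) (e c) * curv br nab Y (e a) (e b) (e c)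

/-- The metric Lie algebra is weakly Einstein:
`Ř(X,Y) = (‖R‖²/n) ⟨X,Y⟩` where `‖R‖² = Σ_i Ř(e_i,e_i)` and `n = dim V`. -/
def WeaklyEinstein (br nab : V → V → V) {ι : Type*} [Fintype ι]
    (e : OrthonormalBasis ι ℝ V) : Prop :=
  ∀ X Y : V, checkR br nab e X Y =
    ((∑ i, checkR br nab e (e i) (e i)) / (Fintype.card ι : ℝ)) * ⟪X, Y⟫_ℝ

/-- The Ricci form `Ric(X,Y) = Σ_a R(e_a,X,Y,e_a)`. -/
def ricci (br nab : V → V → V) {ι : Type*} [Fintype ι]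
    (e : OrthonormalBasis ι ℝ V) (X Y : V) : ℝ :=
  ∑ a, curv br nab (e a) X Y (e a)

/-- The metric Lie algebra is Einstein: the Ricci form is a scalar multiple
of the inner product. -/
def IsEinstein (br nab : V → V → V) {ι : Type*} [Fintype ι]
    (e : OrthonormalBasis ι ℝ V) : Prop :=
  ∃ κ : ℝ, ∀ X Y : V, ricci br nab e X Y = κ * ⟪X, Y⟫_ℝ

/-- A (Lie) bracket is nilpotent: all sufficiently long iterated brackets vanish. -/
def IsNilpotentBracket (br : V → V → V) : Prop :=
  ∃ k : ℕ, ∀ (f : Fin k → V) (X : V), (List.ofFn f).foldr br X = 0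

theorem OrthonormalBasis.sum_mul_eq_of_isLinearMap {ι κ : Type*} [Fintype ι] [Fintype κ]
    (b : OrthonormalBasis ι ℝ V) (b' : OrthonormalBasis κ ℝ V) {g h : V → ℝ}
    (hg : IsLinearMap ℝ g) (hh : IsLinearMap ℝ h) :
    ∑ i, g (b i) * h (b i) = ∑ j, g (b' j) * h (b' j) := by
  have expand : ∀ {f : V → ℝ}, IsLinearMap ℝ f → ∀ v, f v = ∑ j, ⟪b' j, v⟫_ℝ * f (b' j) := by
    intro f hf v
    have := congrArg (hf.mk' f) (b'.sum_repr' v)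
    simpa using this.symm
  calc ∑ i, g (b i) * h (b i)
      = ∑ i, ∑ j, ∑ k, (⟪b' j, b i⟫_ℝ * ⟪b i, b' k⟫_ℝ) * (g (b' j) * h (b' k)) := by
        refine Finset.sum_congr rfl fun i _ => ?_
        rw [expand hg, expand hh, Finset.sum_mul_sum]
        refine Finset.sum_congr rfl fun j _ => Finset.sum_congr rfl fun k _ => ?_
        rw [real_inner_comm (b i) (b' k)]
        ring
    _ = ∑ j, ∑ k, ⟪b' j, b' k⟫_ℝ * (g (b' j) * h (b' k)) := by
        rw [Finset.sum_comm]
        refine Finset.sum_congr rfl fun j _ => ?_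
        rw [Finset.sum_comm]
        refine Finset.sum_congr rfl fun k _ => ?_
        rw [← Finset.sum_mul, b.sum_inner_mul_inner]
    _ = ∑ j, g (b' j) * h (b' j) := by
        classical
        simp [b'.inner_eq_ite]

namespace IsLieBracket

variable {br : V → V → V}

theorem add_right (h : IsLieBracket br) (X Y Z : V) : br X (Y + Z) = br X Y + br X Z := by
  rw [h.antisymm, h.add_left, h.antisymm X Y, h.antisymm X Z, neg_add]

theorem smul_right (h : IsLieBracket br) (c : ℝ) (X Y : V) : br X (c • Y) = c • br X Y := by
  rw [h.antisymm, h.smul_left, h.antisymm X Y, smul_neg]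

theorem self (h : IsLieBracket br) (X : V) : br X X = 0 := by
  have h₂ : (2 : ℝ) • br X X = 0 := by
    rw [two_smul]
    exact add_eq_zero_iff_eq_neg.mpr (h.antisymm X X)
  simpa using h₂

end IsLieBracket

namespace IsLeviCivita

variable {br nab : V → V → V}

theorem add_left (h : IsLeviCivita br nab) (hbr : IsLieBracket br) (X Y Z : V) :
    nab (X + Y) Z = nab X Z + nab Y Z := by
  refine ext_inner_right ℝ fun W => ?_
  simp only [h _ _ _, inner_add_left, inner_add_right, hbr.add_left, hbr.add_right]
  ring

theorem smul_left (h : IsLeviCivita br nab) (hbr : IsLieBracket br) (c : ℝ) (X Y : V) :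
    nab (c • X) Y = c • nab X Y := by
  refine ext_inner_right ℝ fun W => ?_
  simp only [h _ _ _, real_inner_smul_left, real_inner_smul_right, hbr.smul_left, hbr.smul_right]
  ring

theorem add_right (h : IsLeviCivita br nab) (hbr : IsLieBracket br) (X Y Z : V) :
    nab X (Y + Z) = nab X Y + nab X Z := by
  refine ext_inner_right ℝ fun W => ?_
  simp only [h _ _ _, inner_add_left, inner_add_right, hbr.add_left, hbr.add_right]
  ring

theorem smul_right (h : IsLeviCivita br nab) (hbr : IsLieBracket br) (c : ℝ) (X Y : V) :
    nab X (c • Y) = c • nab X Y := by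
  refine ext_inner_right ℝ fun W => ?_
  simp only [h _ _ _, real_inner_smul_left, real_inner_smul_right, hbr.smul_left, hbr.smul_right]
  ring

theorem curv_isLinearMap_second (h : IsLeviCivita br nab) (hbr : IsLieBracket br) (X Z W : V) :
    IsLinearMap ℝ fun Y => curv br nab X Y Z W where
  map_add Y Y' := by
    simp only [curv, curvOp, hbr.add_right, h.add_left hbr, h.add_right hbr, inner_sub_left,
      inner_add_left]
    ring
  map_smul c Y := by
    simp only [curv, curvOp, hbr.smul_right, h.smul_left hbr, h.smul_right hbr, inner_sub_left,
      real_inner_smul_left, smul_eq_mul]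
    ring

theorem curv_isLinearMap_third (h : IsLeviCivita br nab) (hbr : IsLieBracket br) (X Y W : V) :
    IsLinearMap ℝ fun Z => curv br nab X Y Z W where
  map_add Z Z' := by
    simp only [curv, curvOp, h.add_right hbr, inner_sub_left, inner_add_left]
    ring
  map_smul c Z := by
    simp only [curv, curvOp, h.smul_right hbr, inner_sub_left, real_inner_smul_left, smul_eq_mul]
    ring

end IsLeviCivita

theorem curv_isLinearMap_fourth (br nab : V → V → V) (X Y Z : V) :
    IsLinearMap ℝ fun W => curv br nab X Y Z W where
  map_add W W' := by simp only [curv, inner_add_right]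
  map_smul c W := by simp only [curv, real_inner_smul_right, smul_eq_mul]

theorem IsLeviCivita.checkR_eq_checkR {br nab : V → V → V} (h : IsLeviCivita br nab)
    (hbr : IsLieBracket br) {ι κ : Type*} [Fintype ι] [Fintype κ]
    (b : OrthonormalBasis ι ℝ V) (b' : OrthonormalBasis κ ℝ V) (X Y : V) :
    checkR br nab b X Y = checkR br nab b' X Y := by
  unfold checkR
  calc _ = ∑ i, ∑ j, ∑ c, curv br nab X (b i) (b j) (b' c) * curv br nab Y (b i) (b j) (b' c) :=
        Finset.sum_congr rfl fun i _ => Finset.sum_congr rfl fun j _ =>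
          b.sum_mul_eq_of_isLinearMap b' (curv_isLinearMap_fourth br nab _ _ _)
            (curv_isLinearMap_fourth br nab _ _ _)
    _ = ∑ i, ∑ c, ∑ d, curv br nab X (b i) (b' d) (b' c) * curv br nab Y (b i) (b' d) (b' c) := by
        refine Finset.sum_congr rfl fun i _ => ?_
        rw [Finset.sum_comm]
        exact Finset.sum_congr rfl fun c _ =>
          b.sum_mul_eq_of_isLinearMap b' (h.curv_isLinearMap_third hbr _ _ _)
            (h.curv_isLinearMap_third hbr _ _ _)
    _ = ∑ c, ∑ d, ∑ a, curv br nab X (b' a) (b' d) (b' c) *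
          curv br nab Y (b' a) (b' d) (b' c) := by
        rw [Finset.sum_comm]
        refine Finset.sum_congr rfl fun c _ => ?_
        rw [Finset.sum_comm]
        exact Finset.sum_congr rfl fun d _ =>
          b.sum_mul_eq_of_isLinearMap b' (h.curv_isLinearMap_second hbr _ _ _)
            (h.curv_isLinearMap_second hbr _ _ _)
    _ = _ := by
        rw [Finset.sum_comm, Finset.sum_congr rfl fun d _ => Finset.sum_comm, Finset.sum_comm]

theorem weaklyEinstein_iff_exists {br nab : V → V → V} {ι : Type*} [Fintype ι] [Nonempty ι]
    (b : OrthonormalBasis ι ℝ V) :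
    WeaklyEinstein br nab b ↔ ∃ μ : ℝ, ∀ X Y : V, checkR br nab b X Y = μ * ⟪X, Y⟫_ℝ := by
  refine ⟨fun h => ⟨_, h⟩, ?_⟩
  rintro ⟨μ, hμ⟩ X Y
  rw [hμ]
  have : (Fintype.card ι : ℝ) ≠ 0 := Nat.cast_ne_zero.mpr Fintype.card_ne_zero
  simp [hμ, this]

/-- The vector `c e + x`, where `e` spans a complement of the subspace `𝔞`. -/
def addLine (e : V) {𝔞 : Submodule ℝ V} (c : ℝ) (x : 𝔞) : V := c • e + (x : V)

section AlmostAbelian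

variable {𝔞 : Submodule ℝ V} {e : V} {br nab : V → V → V} {Q S : 𝔞 →ₗ[ℝ] 𝔞}

theorem inner_addLine (he : ‖e‖ = 1) (heorth : ∀ X ∈ 𝔞, ⟪e, X⟫_ℝ = 0) (c d : ℝ) (x y : 𝔞) :
    ⟪addLine e c x, addLine e d y⟫_ℝ = c * d + ⟪x, y⟫_ℝ := by
  have h₁ : ⟪e, (y : V)⟫_ℝ = 0 := heorth y y.2
  have h₂ : ⟪(x : V), e⟫_ℝ = 0 := by rw [real_inner_comm]; exact heorth x x.2
  simp [addLine, inner_add_left, inner_add_right, real_inner_smul_left, real_inner_smul_right,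
    h₁, h₂, he, mul_comm]

theorem br_addLine (hbr : IsLieBracket br)
    (habelian : ∀ X Y : V, X ∈ 𝔞 → Y ∈ 𝔞 → br X Y = 0) (hQ : ∀ X : 𝔞, (Q X : V) = br e (X : V))
    (c d : ℝ) (x y : 𝔞) :
    br (addLine e c x) (addLine e d y) = addLine e 0 (c • Q y - d • Q x) := by
  simp only [addLine, hbr.add_left, hbr.add_right, hbr.smul_left, hbr.smul_right, hbr.self,
    habelian x y x.2 y.2, hbr.antisymm (x : V) e, Submodule.coe_sub, Submodule.coe_smul, hQ]
  module

theorem nab_addLine (hbr : IsLieBracket br) (hnab : IsLeviCivita br nab)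
    (habelian : ∀ X Y : V, X ∈ 𝔞 → Y ∈ 𝔞 → br X Y = 0) (he : ‖e‖ = 1)
    (heorth : ∀ X ∈ 𝔞, ⟪e, X⟫_ℝ = 0) (hspan : ∀ v : V, ∃ c, ∃ x : 𝔞, v = addLine e c x)
    (hQ : ∀ X : 𝔞, (Q X : V) = br e (X : V))
    (hS : ∀ x y, ⟪S x, y⟫_ℝ = (1 / 2) * (⟪Q x, y⟫_ℝ + ⟪Q y, x⟫_ℝ)) (c d : ℝ) (x y : 𝔞) :
    nab (addLine e c x) (addLine e d y) =
      addLine e ⟪S x, y⟫_ℝ (c • (Q y - S y) - d • S x) := by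
  refine ext_inner_right ℝ fun W => ?_
  obtain ⟨k, w, rfl⟩ := hspan W
  simp only [hnab _ _ _, br_addLine hbr habelian hQ, inner_addLine he heorth, inner_sub_left,
    real_inner_smul_left, hS]
  ring

theorem curv_addLine (hbr : IsLieBracket br) (hnab : IsLeviCivita br nab)
    (habelian : ∀ X Y : V, X ∈ 𝔞 → Y ∈ 𝔞 → br X Y = 0) (he : ‖e‖ = 1)
    (heorth : ∀ X ∈ 𝔞, ⟪e, X⟫_ℝ = 0) (hspan : ∀ v : V, ∃ c, ∃ x : 𝔞, v = addLine e c x)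
    (hQ : ∀ X : 𝔞, (Q X : V) = br e (X : V))
    (hS : ∀ x y, ⟪S x, y⟫_ℝ = (1 / 2) * (⟪Q x, y⟫_ℝ + ⟪Q y, x⟫_ℝ))
    {T : 𝔞 →ₗ[ℝ] 𝔞} (hT : T = S ∘ₗ S + (S ∘ₗ Q - Q ∘ₗ S)) (p q r s : ℝ) (x y z w : 𝔞) :
    curv br nab (addLine e p x) (addLine e q y) (addLine e r z) (addLine e s w) =
      ⟪S x, z⟫_ℝ * ⟪S y, w⟫_ℝ - ⟪S y, z⟫_ℝ * ⟪S x, w⟫_ℝ +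
        ⟪T (p • y - q • x), r • w - s • z⟫_ℝ := by
  have skew : ∀ u v : 𝔞, ⟪u, Q v⟫_ℝ = ⟪u, S v⟫_ℝ + ⟪S u, v⟫_ℝ - ⟪Q u, v⟫_ℝ := by
    intro u v
    rw [real_inner_comm u (S v) |>.symm, hS, hS, real_inner_comm u (Q v) |>.symm]
    ring
  have symm : ∀ u v : 𝔞, ⟪u, S v⟫_ℝ = ⟪S u, v⟫_ℝ := by
    intro u v
    rw [real_inner_comm u (S v) |>.symm, hS, hS]
    ring
  have hxy : ⟪S (S y), x⟫_ℝ = ⟪S (S x), y⟫_ℝ := by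
    rw [← symm, real_inner_comm, symm]
  simp only [curv, curvOp, br_addLine hbr habelian hQ,
    nab_addLine hbr hnab habelian he heorth hspan hQ hS, inner_sub_left, inner_addLine he heorth,
    hT, LinearMap.add_apply, LinearMap.sub_apply, LinearMap.comp_apply, map_sub, map_smul,
    inner_sub_right, inner_add_left, real_inner_smul_left, real_inner_smul_right, skew, symm, hxy]
  ring

theorem checkR_addLine (hbr : IsLieBracket br) (hnab : IsLeviCivita br nab)
    (habelian : ∀ X Y : V, X ∈ 𝔞 → Y ∈ 𝔞 → br X Y = 0) (he : ‖e‖ = 1)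
    (heorth : ∀ X ∈ 𝔞, ⟪e, X⟫_ℝ = 0) (hspan : ∀ v : V, ∃ c, ∃ x : 𝔞, v = addLine e c x)
    (hQ : ∀ X : 𝔞, (Q X : V) = br e (X : V))
    (hS : ∀ x y, ⟪S x, y⟫_ℝ = (1 / 2) * (⟪Q x, y⟫_ℝ + ⟪Q y, x⟫_ℝ))
    {T : 𝔞 →ₗ[ℝ] 𝔞} (hT : T = S ∘ₗ S + (S ∘ₗ Q - Q ∘ₗ S)) {ι : Type*} [Fintype ι]
    (f : OrthonormalBasis ι ℝ 𝔞) (b : OrthonormalBasis (Option ι) ℝ V)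
    (hb_none : b none = addLine e 1 (0 : 𝔞)) (hb_some : ∀ i, b (some i) = addLine e 0 (f i))
    (p q : ℝ) (x y : 𝔞) :
    checkR br nab b (addLine e p x) (addLine e q y) =
      2 * (p * q * ∑ i, ⟪T (f i), T (f i)⟫_ℝ + ⟪T x, T y⟫_ℝ +
        ((∑ i, ⟪S (f i), S (f i)⟫_ℝ) * ⟪S x, S y⟫_ℝ - ⟪S (S x), S (S y)⟫_ℝ)) := by
  have symm : ∀ u v : 𝔞, ⟪S u, v⟫_ℝ = ⟪u, S v⟫_ℝ := by
    intro u v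
    rw [real_inner_comm u (S v) |>.symm, hS, hS]
    ring
  have parseval : ∀ u v : 𝔞, ∑ i, ⟪u, f i⟫_ℝ * ⟪v, f i⟫_ℝ = ⟪u, v⟫_ℝ := by
    intro u v
    rw [← f.sum_inner_mul_inner u v]
    exact Finset.sum_congr rfl fun i _ => by rw [real_inner_comm v]
  have wedge : ∀ u v u' v' : 𝔞, ∑ j, ∑ k, (⟪u, f j⟫_ℝ * ⟪v, f k⟫_ℝ - ⟪v, f j⟫_ℝ * ⟪u, f k⟫_ℝ) *
      (⟪u', f j⟫_ℝ * ⟪v', f k⟫_ℝ - ⟪v', f j⟫_ℝ * ⟪u', f k⟫_ℝ) =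
      2 * (⟪u, u'⟫_ℝ * ⟪v, v'⟫_ℝ - ⟪u, v'⟫_ℝ * ⟪v, u'⟫_ℝ) := by
    intro u v u' v'
    have : ∀ j k, (⟪u, f j⟫_ℝ * ⟪v, f k⟫_ℝ - ⟪v, f j⟫_ℝ * ⟪u, f k⟫_ℝ) *
        (⟪u', f j⟫_ℝ * ⟪v', f k⟫_ℝ - ⟪v', f j⟫_ℝ * ⟪u', f k⟫_ℝ) =
        (⟪u, f j⟫_ℝ * ⟪u', f j⟫_ℝ) * (⟪v, f k⟫_ℝ * ⟪v', f k⟫_ℝ) -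
        (⟪u, f j⟫_ℝ * ⟪v', f j⟫_ℝ) * (⟪v, f k⟫_ℝ * ⟪u', f k⟫_ℝ) -
        (⟪v, f j⟫_ℝ * ⟪u', f j⟫_ℝ) * (⟪u, f k⟫_ℝ * ⟪v', f k⟫_ℝ) +
        (⟪v, f j⟫_ℝ * ⟪v', f j⟫_ℝ) * (⟪u, f k⟫_ℝ * ⟪u', f k⟫_ℝ) := by
      intro j k; ring
    simp only [this, Finset.sum_add_distrib, Finset.sum_sub_distrib, ← Finset.mul_sum,
      ← Finset.sum_mul, parseval]
    ring
  have cross : ∑ i, ⟪S x, S (f i)⟫_ℝ * ⟪S (f i), S y⟫_ℝ = ⟪S (S x), S (S y)⟫_ℝ := by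
    rw [← parseval]
    refine Finset.sum_congr rfl fun i _ => ?_
    rw [symm (S x), symm (S y), real_inner_comm (S y)]
  simp only [checkR, Fintype.sum_option, hb_none, hb_some,
    curv_addLine hbr hnab habelian he heorth hspan hQ hS hT]
  simp only [map_zero, inner_zero_left, inner_zero_right, mul_zero, zero_mul, zero_smul, one_smul, smul_zero,
    sub_zero, zero_sub, map_neg, inner_neg_left, inner_neg_right, map_smul,
    real_inner_smul_left, sub_self, add_zero, zero_add, neg_neg, neg_mul_neg, parseval,
    Finset.sum_const_zero, wedge, Finset.sum_add_distrib]
  have line : ∀ i, ∑ k, p * ⟪T (f i), f k⟫_ℝ * (q * ⟪T (f i), f k⟫_ℝ) =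
      p * q * ⟪T (f i), T (f i)⟫_ℝ := by
    intro i
    rw [← parseval, Finset.mul_sum]
    exact Finset.sum_congr rfl fun k _ => by ring
  simp only [line, ← Finset.mul_sum, Finset.sum_sub_distrib, cross]
  ring

end AlmostAbelian

/-- If `∑ⱼ (xⱼ² + kⱼ) = kᵢ + (∑ⱼ xⱼ) xᵢ` for every `i`, with all `xᵢ` and `kᵢ` nonnegative,
then the `xᵢ` are all equal, and the `kᵢ` vanish unless there is only one index. -/
theorem eq_and_eq_zero_of_sum_sq_add_eq {ι : Type*} [Fintype ι] {x k : ι → ℝ}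
    (hx : ∀ i, 0 ≤ x i) (hk : ∀ i, 0 ≤ k i)
    (h : ∀ i, ∑ j, (x j ^ 2 + k j) = k i + (∑ j, x j) * x i) :
    (∀ i j, x i = x j) ∧ (Nontrivial ι → ∀ i, k i = 0) := by
  classical
  rcases isEmpty_or_nonempty ι with _ | _
  · exact ⟨fun i => isEmptyElim i, fun _ i => isEmptyElim i⟩
  obtain ⟨i₀, hi₀⟩ := Finite.exists_max x
  set l := ∑ j, (x j ^ 2 + k j) with hl
  set σ := ∑ j, x j with hσ
  have hσ0 : 0 ≤ σ := Finset.sum_nonneg fun j _ => hx j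
  set m : ℝ := (Fintype.card ι : ℝ) with hm
  have hm1 : 1 ≤ m := by
    rw [hm]; exact_mod_cast Fintype.card_pos
  have hsum : m * l = ∑ j, k j + σ * σ := by
    have : ∑ i : ι, l = ∑ i, (k i + σ * x i) := Finset.sum_congr rfl fun i _ => h i
    rw [Finset.sum_add_distrib, ← Finset.mul_sum] at this
    simpa using this
  have hl' : l = ∑ j, x j ^ 2 + ∑ j, k j := by rw [hl, Finset.sum_add_distrib]
  have hmax : σ * x i₀ ≤ l := by
    have := h i₀
    linarith [hk i₀]
  have hdefect : ∑ i, x i * (((m - 1) * x i₀) - (σ - x i)) ≤ 0 := by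
    have : ∑ i, x i * (((m - 1) * x i₀) - (σ - x i)) =
        (m - 1) * x i₀ * σ - σ * σ + ∑ i, x i ^ 2 := by
      rw [hσ, Finset.mul_sum, Finset.mul_sum, ← Finset.sum_sub_distrib, ← Finset.sum_add_distrib]
      refine Finset.sum_congr rfl fun i _ => ?_
      ring
    rw [this]
    nlinarith [mul_le_mul_of_nonneg_left hmax (sub_nonneg.mpr hm1)]
  have hgap : ∀ i, ((m - 1) * x i₀) - (σ - x i) = ∑ j ∈ Finset.univ.erase i, (x i₀ - x j) := by
    intro i
    have h₁ := Finset.add_sum_erase Finset.univ (fun j => x i₀ - x j) (Finset.mem_univ i)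
    have h₂ : ∑ j, (x i₀ - x j) = m * x i₀ - σ := by simp [hm, hσ]
    rw [h₂] at h₁
    linarith
  have hgap0 : ∀ i, 0 ≤ ((m - 1) * x i₀) - (σ - x i) := fun i => by
    rw [hgap]
    exact Finset.sum_nonneg fun j _ => sub_nonneg.mpr (hi₀ j)
  have hterm : x i₀ * (((m - 1) * x i₀) - (σ - x i₀)) = 0 :=
    (Finset.sum_eq_zero_iff_of_nonneg fun i _ => mul_nonneg (hx i) (hgap0 i)).mp
      (le_antisymm hdefect (Finset.sum_nonneg fun i _ => mul_nonneg (hx i) (hgap0 i)))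
      i₀ (Finset.mem_univ _)
  have hall : ∀ j, x j = x i₀ := by
    intro j
    rcases mul_eq_zero.mp hterm with h0 | h0
    · exact le_antisymm (hi₀ j) (h0 ▸ hx j)
    · by_cases hj : j = i₀
      · rw [hj]
      · rw [hgap] at h0
        have := (Finset.sum_eq_zero_iff_of_nonneg
          fun j _ => sub_nonneg.mpr (hi₀ j)).mp h0 j (by simp [hj])
        linarith
  refine ⟨fun i j => (hall i).trans (hall j).symm, fun hι => ?_⟩
  have hm2 : 1 < m := by
    rw [hm]; exact_mod_cast Fintype.one_lt_card
  have hσm : σ = m * x i₀ := by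
    rw [hσ, Finset.sum_congr rfl fun j _ => hall j]; simp [hm]
  have hsq : ∑ j, x j ^ 2 = m * x i₀ ^ 2 := by
    rw [Finset.sum_congr rfl fun j _ => by rw [hall j]]; simp [hm]
  have hlval : l = m * x i₀ ^ 2 := by
    refine mul_left_cancel₀ (sub_ne_zero.mpr hm2.ne') ?_
    rw [hσm] at hsum
    linear_combination hsum - hl' - hsq
  intro i
  have := h i
  rw [hall i, hσm, hlval] at this
  linarith

/-- An orthonormal basis of a hyperplane, extended by a unit normal vector. -/
theorem exists_orthonormalBasis_option [FiniteDimensional ℝ V] {𝔞 : Submodule ℝ V} {e : V}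
    (he : ‖e‖ = 1) (heorth : ∀ X ∈ 𝔞, ⟪e, X⟫_ℝ = 0)
    (hcodim : finrank ℝ 𝔞 + 1 = finrank ℝ V) {ι : Type*} [Fintype ι]
    (f : OrthonormalBasis ι ℝ 𝔞) :
    ∃ b : OrthonormalBasis (Option ι) ℝ V,
      b none = addLine e 1 (0 : 𝔞) ∧ ∀ i, b (some i) = addLine e 0 (f i) := by
  classical
  let v : Option ι → V := fun o => o.elim (addLine e 1 (0 : 𝔞)) fun i => addLine e 0 (f i)
  have hv : Orthonormal ℝ v := by
    rw [orthonormal_iff_ite]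
    rintro (_ | i) (_ | j) <;>
      simp only [v, Option.elim_none, Option.elim_some, inner_addLine he heorth, f.inner_eq_ite] <;>
      simp
  have hcard : Fintype.card (Option ι) = finrank ℝ V := by
    rw [Fintype.card_option, ← hcodim, finrank_eq_card_basis f.toBasis]
  have hspan := (basisOfOrthonormalOfCardEqFinrank hv hcard).span_eq
  rw [coe_basisOfOrthonormalOfCardEqFinrank] at hspan
  exact ⟨OrthonormalBasis.mk hv hspan.ge, by simp [v], fun i => by simp [v]⟩

theorem exists_eq_addLine {𝔞 : Submodule ℝ V} {e : V} {ι : Type*} [Fintype ι]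
    (f : ι → 𝔞) (b : OrthonormalBasis (Option ι) ℝ V)
    (hb_none : b none = addLine e 1 (0 : 𝔞)) (hb_some : ∀ i, b (some i) = addLine e 0 (f i))
    (v : V) : ∃ c, ∃ x : 𝔞, v = addLine e c x := by
  refine ⟨⟪b none, v⟫_ℝ, ∑ i, ⟪b (some i), v⟫_ℝ • f i, ?_⟩
  conv_lhs => rw [← b.sum_repr' v]
  have h₁ : b none = e := by simp [hb_none, addLine]
  have h₂ : ∀ i, b (some i) = (f i : V) := fun i => by simp [hb_some, addLine]
  simp [Fintype.sum_option, addLine, h₁, h₂]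

/-- An almost abelian metric Lie algebra of dimension `n ≥ 2` is
weakly Einstein if and only if `Q = ad(e)|_𝔞` is normal and the square of its
symmetric part `S = (1/2)(Q + Qᵗ)` is a multiple of the identity. -/
theorem weaklyEinstein_almostAbelian_iff
    {V : Type*} [NormedAddCommGroup V] [InnerProductSpace ℝ V] [FiniteDimensional ℝ V]
    (n : ℕ) (hn : 2 ≤ n) (hdimV : finrank ℝ V = n)
    (br : V → V → V) (hbr : IsLieBracket br)
    (nab : V → V → V) (hnab : IsLeviCivita br nab)
    (𝔞 : Submodule ℝ V)
    (hcodim : finrank ℝ 𝔞 + 1 = n)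
    (habelian : ∀ X Y : V, X ∈ 𝔞 → Y ∈ 𝔞 → br X Y = 0)
    (hideal : ∀ X Y : V, Y ∈ 𝔞 → br X Y ∈ 𝔞)
    (e : V) (he : ‖e‖ = 1) (heorth : ∀ X ∈ 𝔞, ⟪e, X⟫_ℝ = 0)
    (Q : 𝔞 →ₗ[ℝ] 𝔞) (hQ : ∀ X : 𝔞, (Q X : V) = br e (X : V))
    (S : 𝔞 →ₗ[ℝ] 𝔞) (hS : S = (1 / 2 : ℝ) • (Q + LinearMap.adjoint Q))
    (basis : OrthonormalBasis (Fin n) ℝ V) :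
    WeaklyEinstein br nab basis ↔
      (Q ∘ₗ LinearMap.adjoint Q = LinearMap.adjoint Q ∘ₗ Q ∧
        ∃ a : ℝ, S ∘ₗ S = (a ^ 2) • LinearMap.id) := by
  subst hdimV
  have : Nonempty (Fin (finrank ℝ V)) := ⟨⟨0, by omega⟩⟩
  have hS' : ∀ x y, ⟪S x, y⟫_ℝ = (1 / 2) * (⟪Q x, y⟫_ℝ + ⟪Q y, x⟫_ℝ) := by
    intro x y
    simp only [hS, LinearMap.smul_apply, LinearMap.add_apply, real_inner_smul_left,
      inner_add_left, LinearMap.adjoint_inner_left]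
    rw [real_inner_comm x (Q y)]
  have hsymm : S.IsSymmetric := by
    intro x y
    rw [real_inner_comm (S y), hS', hS']
    ring
  set f := hsymm.eigenvectorBasis rfl
  set s := hsymm.eigenvalues rfl
  have hSf : ∀ i, S (f i) = s i • f i := fun i => hsymm.apply_eigenvectorBasis rfl i
  obtain ⟨b, hb_none, hb_some⟩ := exists_orthonormalBasis_option he heorth hcodim f
  have hspan := exists_eq_addLine f b hb_none hb_some
  set K : 𝔞 →ₗ[ℝ] 𝔞 := S ∘ₗ Q - Q ∘ₗ S with hK
  have hnormal : Q ∘ₗ LinearMap.adjoint Q = LinearMap.adjoint Q ∘ₗ Q ↔ K = 0 := by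
    have : K = (1 / 2 : ℝ) • (LinearMap.adjoint Q ∘ₗ Q - Q ∘ₗ LinearMap.adjoint Q) := by
      rw [hK, hS]
      ext1 x
      simp only [LinearMap.sub_apply, LinearMap.comp_apply, LinearMap.smul_apply,
        LinearMap.add_apply, map_smul, map_add]
      module
    rw [this, smul_eq_zero_iff_right (by norm_num), sub_eq_zero, eq_comm]
  have hcheck := checkR_addLine hbr hnab habelian he heorth hspan hQ hS'
    (T := S ∘ₗ S + K) rfl f b hb_none hb_some
  rw [weaklyEinstein_iff_exists, hnormal]
  simp only [hnab.checkR_eq_checkR hbr basis b]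
  constructor
  · rintro ⟨μ, hμ⟩
    have hKf : ∀ i, ⟪f i, K (f i)⟫_ℝ = 0 := by
      intro i
      simp only [hK, LinearMap.sub_apply, LinearMap.comp_apply, inner_sub_right, hSf, map_smul,
        real_inner_smul_right]
      rw [← hsymm, hSf, real_inner_smul_left, sub_self]
    have hSS : ∀ i, S (S (f i)) = s i ^ 2 • f i := by
      intro i
      rw [hSf, map_smul, hSf, smul_smul, sq]
    have hff : ∀ i, ⟪f i, f i⟫_ℝ = 1 := fun i => by simp
    have hTT : ∀ i, ⟪(S ∘ₗ S + K) (f i), (S ∘ₗ S + K) (f i)⟫_ℝ =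
        (s i ^ 2) ^ 2 + ⟪K (f i), K (f i)⟫_ℝ := by
      intro i
      simp only [LinearMap.add_apply, LinearMap.comp_apply, hSS, inner_add_left, inner_add_right,
        real_inner_smul_left, real_inner_smul_right, hff, hKf, real_inner_comm (f i) (K (f i))]
      ring
    have hSn : ∀ i, ⟪S (f i), S (f i)⟫_ℝ = s i ^ 2 := by
      intro i
      simp only [hSf, real_inner_smul_left, real_inner_smul_right, hff]
      ring
    have hSSn : ∀ i, ⟪S (S (f i)), S (S (f i))⟫_ℝ = (s i ^ 2) ^ 2 := by
      intro i
      simp only [hSS, real_inner_smul_left, real_inner_smul_right, hff]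
      ring
    have hline := hcheck 1 1 0 0
    simp only [hμ, inner_addLine he heorth, map_zero, inner_zero_left, hTT] at hline
    obtain ⟨heq, hzero⟩ := eq_and_eq_zero_of_sum_sq_add_eq (x := fun i => s i ^ 2)
      (k := fun i => ⟪K (f i), K (f i)⟫_ℝ) (fun i => sq_nonneg _)
      (fun i => real_inner_self_nonneg) fun i => by
        have hi := hcheck 0 0 (f i) (f i)
        simp only [hμ, inner_addLine he heorth, hTT, hSn, hSSn, hff] at hi
        linarith
    refine ⟨f.toBasis.ext fun i => ?_, s ⟨0, by omega⟩, f.toBasis.ext fun i => ?_⟩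
    · rw [OrthonormalBasis.coe_toBasis, LinearMap.zero_apply]
      rcases subsingleton_or_nontrivial (Fin (finrank ℝ 𝔞)) with _ | hnt
      · rw [← f.sum_repr' (K (f i))]
        exact Finset.sum_eq_zero fun j _ => by rw [Subsingleton.elim j i, hKf, zero_smul]
      · exact inner_self_eq_zero.mp (hzero hnt i)
    · simp only [OrthonormalBasis.coe_toBasis, LinearMap.comp_apply, hSS, LinearMap.smul_apply,
        LinearMap.id_apply]
      rw [heq i]
  · rintro ⟨hK0, a, ha⟩
    have hSS : ∀ x, S (S x) = a ^ 2 • x := fun x => LinearMap.congr_fun ha x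
    have hSin : ∀ x y, ⟪S x, S y⟫_ℝ = a ^ 2 * ⟪x, y⟫_ℝ := by
      intro x y
      rw [hsymm, hSS, real_inner_smul_right]
    refine ⟨2 * (finrank ℝ 𝔞 * a ^ 4), fun X Y => ?_⟩
    obtain ⟨p, x, rfl⟩ := hspan X
    obtain ⟨q, y, rfl⟩ := hspan Y
    rw [hcheck, inner_addLine he heorth]
    simp only [hK0, add_zero, LinearMap.comp_apply, hSS, hSin, real_inner_smul_left,
      real_inner_smul_right, f.inner_eq_one, Finset.sum_const, Finset.card_univ,
      Fintype.card_fin, nsmul_eq_mul]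
    ring
end
end

section
/- Let V be a real inner product space of finite dimension m ≥ 1, let S be a symmetric and K a skew-symmetric endomorphism of V, and set P = (SK − KS) + S². Then P² + Tr(S²)·S² − S⁴ = Tr(P²)·id_V holds if and only if SK = KS and S² = a²·id_V for some a ∈ ℝ. -/
open Module
open scoped InnerProductSpace

noncomputable section

/-- If `t - (∑ μ) * μ i ≥ 0` for all `i` and these numbers together with the `μ i ^ 2` sum up
to `t`, then `t = (∑ μ) * μ i` for all `i`, provided there are at least two indices. -/
lemma eq_sum_mul_of_nonneg_of_sum_eq {ι : Type*} [Fintype ι] (hι : 2 ≤ Fintype.card ι)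
    {μ : ι → ℝ} (hμ : ∀ i, 0 ≤ μ i) {t : ℝ} (hle : ∀ i, (∑ j, μ j) * μ i ≤ t)
    (ht : t = ∑ i, (t - (∑ j, μ j) * μ i) + ∑ i, μ i ^ 2) (i : ι) :
    t = (∑ j, μ j) * μ i := by
  set s := ∑ j, μ j with hs
  have hcard : (2 : ℝ) ≤ Fintype.card ι := by exact_mod_cast hι
  have hsum : ∑ i, (t - s * μ i) = Fintype.card ι * t - s * s := by
    rw [Finset.sum_sub_distrib, ← Finset.mul_sum, ← hs]
    simp
  have hle' (i : ι) : μ i ≤ s := Finset.single_le_sum (fun j _ => hμ j) (Finset.mem_univ i)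
  have hzero : ∑ i, (t - s * μ i) * (s - μ i) = 0 := by
    have h : ∑ i, (t - s * μ i) * (s - μ i)
        = s * ∑ i, (t - s * μ i) - t * ∑ i, μ i + s * ∑ i, μ i ^ 2 := by
      simp only [Finset.mul_sum, ← Finset.sum_sub_distrib, ← Finset.sum_add_distrib]
      exact Finset.sum_congr rfl fun _ _ => by ring
    rw [h, ← hs]
    linear_combination -s * ht
  have hi := (Finset.sum_eq_zero_iff_of_nonneg fun j _ =>
    mul_nonneg (sub_nonneg.2 (hle j)) (sub_nonneg.2 (hle' j))).1 hzero i (Finset.mem_univ i)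
  rcases mul_eq_zero.1 hi with h | h
  · linarith
  · have hsi : μ i = s := by linarith
    have hsq : μ i ^ 2 ≤ ∑ j, μ j ^ 2 :=
      Finset.single_le_sum (f := fun j => μ j ^ 2) (fun j _ => sq_nonneg _) (Finset.mem_univ i)
    have hti := hle i
    rw [hsi] at hsq hti ⊢
    nlinarith [mul_self_nonneg s]

/-- The commutator of a symmetric and a skew-symmetric endomorphism is symmetric. -/
lemma isSymmetric_commutator_of_isSymmetric_of_skew
    {V : Type*} [NormedAddCommGroup V] [InnerProductSpace ℝ V] {S K : V →ₗ[ℝ] V}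
    (hS : S.IsSymmetric) (hK : ∀ x y : V, ⟪K x, y⟫_ℝ = - ⟪x, K y⟫_ℝ) :
    (S ∘ₗ K - K ∘ₗ S).IsSymmetric := by
  intro x y
  simp only [LinearMap.sub_apply, LinearMap.comp_apply, inner_sub_left, inner_sub_right]
  rw [hS, hK, hK, hS]
  ring

/-- For a symmetric endomorphism `S` and a skew-symmetric
endomorphism `K` of a finite-dimensional real inner product space `V` of
dimension `m ≥ 1`, setting `P = [S,K] + S²`, the identity
`P² + Tr(S²)·S² − S⁴ = Tr(P²)·id` holds if and only if `SK = KS` and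
`S² = a²·id` for some real `a`. -/
theorem matrix_weaklyEinstein_iff
    {V : Type*} [NormedAddCommGroup V] [InnerProductSpace ℝ V] [FiniteDimensional ℝ V]
    (m : ℕ) (hm : 1 ≤ m) (hdim : finrank ℝ V = m)
    (S K : V →ₗ[ℝ] V)
    (hS : LinearMap.IsSymmetric S)
    (hK : ∀ x y : V, ⟪K x, y⟫_ℝ = - ⟪x, K y⟫_ℝ)
    (P : V →ₗ[ℝ] V) (hP : P = (S ∘ₗ K - K ∘ₗ S) + S ∘ₗ S) :
    P ∘ₗ P + (LinearMap.trace ℝ V (S ∘ₗ S)) • (S ∘ₗ S) - (S ∘ₗ S) ∘ₗ (S ∘ₗ S)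
        = (LinearMap.trace ℝ V (P ∘ₗ P)) • LinearMap.id ↔
      (S ∘ₗ K = K ∘ₗ S ∧ ∃ a : ℝ, S ∘ₗ S = (a ^ 2) • LinearMap.id) := by
  constructor
  · intro h
    set C := S ∘ₗ K - K ∘ₗ S with hC
    have hCsymm : C.IsSymmetric := isSymmetric_commutator_of_isSymmetric_of_skew hS hK
    let b := hS.eigenvectorBasis hdim
    let l := hS.eigenvalues hdim
    have hb (i : Fin m) : S (b i) = l i • b i := hS.apply_eigenvectorBasis hdim i
    have hSS (i : Fin m) : (S ∘ₗ S) (b i) = (l i ^ 2) • b i := by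
      rw [LinearMap.comp_apply, hb, map_smul, hb, smul_smul, sq]
    have hone (i : Fin m) : ⟪b i, b i⟫_ℝ = 1 := by
      rw [real_inner_self_eq_norm_sq, b.orthonormal.1 i, one_pow]
    have hdiag (i : Fin m) : ⟪b i, C (b i)⟫_ℝ = 0 := by
      rw [hC, LinearMap.sub_apply, LinearMap.comp_apply, LinearMap.comp_apply, inner_sub_right,
        ← hS, hb, map_smul, real_inner_smul_left, real_inner_smul_right, sub_self]
    have hPP (i : Fin m) :
        ⟪b i, (P ∘ₗ P) (b i)⟫_ℝ = ‖C (b i)‖ ^ 2 + (l i ^ 2) ^ 2 := by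
      have hPsymm : P.IsSymmetric := by
        rw [hP]
        exact hCsymm.add fun x y => by
          rw [LinearMap.comp_apply, LinearMap.comp_apply, hS, hS]
      have hCi : ⟪C (b i), b i⟫_ℝ = 0 := by rw [hCsymm, hdiag]
      rw [LinearMap.comp_apply, ← hPsymm, hP, LinearMap.add_apply, hSS]
      simp only [inner_add_left, inner_add_right, real_inner_smul_left, real_inner_smul_right,
        hdiag, hCi, hone, real_inner_self_eq_norm_sq (C (b i))]
      ring
    have hs : LinearMap.trace ℝ V (S ∘ₗ S) = ∑ i, l i ^ 2 := by
      rw [LinearMap.trace_eq_sum_inner _ b]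
      exact Finset.sum_congr rfl fun i _ => by
        rw [hSS, real_inner_smul_right, hone, mul_one]
    set t := LinearMap.trace ℝ V (P ∘ₗ P) with ht
    have hnorm (i : Fin m) : ‖C (b i)‖ ^ 2 = t - (∑ j, l j ^ 2) * l i ^ 2 := by
      have hi := congrArg (fun T : V →ₗ[ℝ] V => ⟪b i, T (b i)⟫_ℝ) h
      simp only [LinearMap.add_apply, LinearMap.sub_apply, LinearMap.smul_apply, inner_add_right,
        inner_sub_right, real_inner_smul_right, LinearMap.id_apply, hPP] at hi
      rw [LinearMap.comp_apply (S ∘ₗ S), hSS, map_smul, hSS, hs] at hi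
      simp only [real_inner_smul_right, hone] at hi
      linear_combination hi
    have htsum : t = ∑ i, (t - (∑ j, l j ^ 2) * l i ^ 2) + ∑ i, (l i ^ 2) ^ 2 := by
      rw [← Finset.sum_congr rfl fun i _ => hnorm i, ← Finset.sum_add_distrib, ht,
        LinearMap.trace_eq_sum_inner _ b]
      exact Finset.sum_congr rfl fun i _ => hPP i
    have hkey : (∀ i, C (b i) = 0) ∧ ∀ i j, l i ^ 2 = l j ^ 2 := by
      obtain rfl | hm2 : m = 1 ∨ 2 ≤ m := by omega
      · refine ⟨fun i => ?_, fun i j => by rw [Subsingleton.elim i j]⟩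
        rw [← b.sum_repr' (C (b i))]
        exact Finset.sum_eq_zero fun j _ => by rw [Subsingleton.elim j i, hdiag, zero_smul]
      · have hts := eq_sum_mul_of_nonneg_of_sum_eq (by simpa using hm2) (fun i => sq_nonneg (l i))
          (fun i => sub_nonneg.1 (hnorm i ▸ sq_nonneg _)) htsum
        refine ⟨fun i => ?_, fun i j => ?_⟩
        · rw [← norm_eq_zero, ← sq_eq_zero_iff, hnorm, sub_eq_zero]
          exact hts i
        · by_cases hs0 : ∑ k, l k ^ 2 = 0
          · have hl := (Finset.sum_eq_zero_iff_of_nonneg fun k _ => sq_nonneg (l k)).1 hs0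
            rw [hl i (Finset.mem_univ i), hl j (Finset.mem_univ j)]
          · exact mul_left_cancel₀ hs0 ((hts i).symm.trans (hts j))
    refine ⟨sub_eq_zero.1 (b.toBasis.ext fun i => ?_), l ⟨0, hm⟩, b.toBasis.ext fun i => ?_⟩
    · rw [OrthonormalBasis.coe_toBasis]
      exact hkey.1 i
    · rw [OrthonormalBasis.coe_toBasis, hSS, hkey.2 i ⟨0, hm⟩]
      rfl
  · rintro ⟨hcomm, a, ha⟩
    rw [hP, hcomm, sub_self, zero_add, ha, add_sub_cancel_left]
    simp only [LinearMap.smul_comp, LinearMap.id_comp, map_smul, smul_smul, smul_eq_mul]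
    congr 1
    ring
end
end

section
/- Let S be a symmetric and K a skew-symmetric endomorphism of a finite-dimensional real inner product space. If Tr([S,K]²·S²) = Tr([S,K]²)·Tr(S²), then [S,K] = 0, i.e., SK = KS. -/
open Module
open scoped InnerProductSpace

noncomputable section

/-- If `S` is symmetric and `K` skew-symmetric on a
finite-dimensional real inner product space and
`Tr([S,K]²·S²) = Tr([S,K]²)·Tr(S²)`, then `[S,K] = 0`, i.e. `SK = KS`. -/
theorem commutator_trace_eq_implies_commute
    {V : Type*} [NormedAddCommGroup V] [InnerProductSpace ℝ V] [FiniteDimensional ℝ V]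
    (S K : V →ₗ[ℝ] V)
    (hS : LinearMap.IsSymmetric S)
    (hK : ∀ x y : V, ⟪K x, y⟫_ℝ = - ⟪x, K y⟫_ℝ)
    (htr : LinearMap.trace ℝ V ((S ∘ₗ K - K ∘ₗ S) ∘ₗ (S ∘ₗ K - K ∘ₗ S) ∘ₗ (S ∘ₗ S))
        = LinearMap.trace ℝ V ((S ∘ₗ K - K ∘ₗ S) ∘ₗ (S ∘ₗ K - K ∘ₗ S))
          * LinearMap.trace ℝ V (S ∘ₗ S)) :
    S ∘ₗ K = K ∘ₗ S := by
  set C : V →ₗ[ℝ] V := S ∘ₗ K - K ∘ₗ S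
  have C_apply (x : V) : C x = S (K x) - K (S x) := rfl
  have C_symm (x y : V) : ⟪x, C y⟫_ℝ = ⟪C x, y⟫_ℝ := by
    rw [C_apply, C_apply, inner_sub_left, inner_sub_right, hK, hS, hK, ← hS x,
      ← neg_eq_iff_eq_neg.mpr (hK x (S y))]
    ring
  let b := hS.eigenvectorBasis rfl
  let eig := hS.eigenvalues rfl
  have S_b (i) : S (b i) = eig i • b i := hS.apply_eigenvectorBasis rfl i
  have trace_SS : LinearMap.trace ℝ V (S ∘ₗ S) = ∑ i, eig i ^ 2 := by
    rw [LinearMap.trace_eq_sum_inner _ b]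
    refine Finset.sum_congr rfl fun i _ => ?_
    simp [S_b, inner_smul_right, sq]
  have trace_CC : LinearMap.trace ℝ V (C ∘ₗ C) = ∑ i, ‖C (b i)‖ ^ 2 := by
    rw [LinearMap.trace_eq_sum_inner _ b]
    refine Finset.sum_congr rfl fun i _ => ?_
    rw [LinearMap.comp_apply, C_symm, real_inner_self_eq_norm_sq]
  have trace_CCSS : LinearMap.trace ℝ V (C ∘ₗ C ∘ₗ S ∘ₗ S) =
      ∑ i, ‖C (b i)‖ ^ 2 * eig i ^ 2 := by
    rw [LinearMap.trace_eq_sum_inner _ b]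
    refine Finset.sum_congr rfl fun i _ => ?_
    simp only [LinearMap.comp_apply, S_b, map_smul, inner_smul_right]
    rw [C_symm, real_inner_self_eq_norm_sq]
    ring
  rw [trace_CCSS, trace_CC, trace_SS, Finset.sum_mul, eq_comm, ← sub_eq_zero,
    ← Finset.sum_sub_distrib] at htr
  have eig_sq_le (i) : eig i ^ 2 ≤ ∑ j, eig j ^ 2 :=
    Finset.single_le_sum (f := fun j => eig j ^ 2) (fun j _ => sq_nonneg _) (Finset.mem_univ i)
  have eig_sq_eq (i) (hi : C (b i) ≠ 0) : eig i ^ 2 = ∑ j, eig j ^ 2 := by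
    have h := (Finset.sum_eq_zero_iff_of_nonneg fun j _ => by
      rw [← mul_sub]
      exact mul_nonneg (sq_nonneg _) (sub_nonneg.mpr (eig_sq_le j))).mp htr i (Finset.mem_univ i)
    rw [← mul_sub, mul_eq_zero, sub_eq_zero] at h
    exact (h.resolve_left (by simpa using hi)).symm
  have C_entry (i j) : ⟪b j, C (b i)⟫_ℝ = (eig j - eig i) * ⟪b j, K (b i)⟫_ℝ := by
    rw [C_apply, inner_sub_right, ← hS, S_b, S_b, map_smul, real_inner_smul_left,
      real_inner_smul_right, sub_mul]
  have C_entry_zero (i j) : ⟪b j, C (b i)⟫_ℝ = 0 := by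
    by_contra h
    have hi := eig_sq_eq i fun h0 => h (by rw [h0, inner_zero_right])
    have hj := eig_sq_eq j fun h0 => h (by rw [C_symm, h0, inner_zero_left])
    have hij : i ≠ j := by
      rintro rfl
      exact h (by rw [C_entry, sub_self, zero_mul])
    have hle : eig i ^ 2 + eig j ^ 2 ≤ ∑ k, eig k ^ 2 := by
      rw [← Finset.sum_pair (f := fun k => eig k ^ 2) hij]
      exact Finset.sum_le_sum_of_subset_of_nonneg (Finset.subset_univ _)
        fun k _ _ => sq_nonneg _
    have hi0 : eig i = 0 := by nlinarith
    have hj0 : eig j = 0 := by nlinarith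
    exact h (by rw [C_entry, hi0, hj0, sub_self, zero_mul])
  refine sub_eq_zero.mp (b.toBasis.ext fun i => ?_)
  rw [b.coe_toBasis, LinearMap.zero_apply]
  exact InnerProductSpace.ext_inner_left_basis b.toBasis fun j => by
    rw [b.coe_toBasis, C_entry_zero, inner_zero_right]
end
end

section
/- Let (𝔤,⟨·,·⟩) be a nilpotent, non-abelian metric Lie algebra containing an abelian ideal of codimension 1. Then (𝔤,⟨·,·⟩) is not weakly Einstein. -/
open Module
open scoped InnerProductSpace BigOperators

noncomputable section

variable {V : Type*} [NormedAddCommGroup V] [InnerProductSpace ℝ V]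

/-- The Hilbert–Schmidt norm does not depend on the orthonormal basis. -/
theorem OrthonormalBasis.sum_norm_sq_apply_eq [FiniteDimensional ℝ V]
    {ι κ : Type*} [Fintype ι] [Fintype κ]
    (e : OrthonormalBasis ι ℝ V) (f : OrthonormalBasis κ ℝ V) (L : V →ₗ[ℝ] V) :
    ∑ i, ‖L (e i)‖ ^ 2 = ∑ i, ‖L (f i)‖ ^ 2 := by
  have key : ∀ v : V, ‖L v‖ ^ 2 = ⟪v, (LinearMap.adjoint L ∘ₗ L) v⟫_ℝ := fun v => by
    rw [LinearMap.comp_apply, LinearMap.adjoint_inner_right, real_inner_self_eq_norm_sq]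
  simp only [key]
  rw [← LinearMap.trace_eq_sum_inner _ e, ← LinearMap.trace_eq_sum_inner _ f]

/-- `Ř(X,X)` can be computed in any orthonormal basis. -/
theorem checkR_self_eq [FiniteDimensional ℝ V] {ι κ : Type*} [Fintype ι] [Fintype κ]
    (B N : V →ₗ[ℝ] V →ₗ[ℝ] V)
    (e : OrthonormalBasis ι ℝ V) (f : OrthonormalBasis κ ℝ V) (X : V) :
    checkR (fun U W => B U W) (fun U W => N U W) e X X =
      ∑ a, ∑ b, ‖curvOp (fun U W => B U W) (fun U W => N U W) X (f a) (f b)‖ ^ 2 := by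
  let C : V →ₗ[ℝ] V →ₗ[ℝ] V := LinearMap.mk₂ ℝ
    (fun Y Z => curvOp (fun U W => B U W) (fun U W => N U W) X Y Z)
    (fun _ _ _ => by simp only [curvOp, map_add, LinearMap.add_apply]; abel)
    (fun _ _ _ => by simp only [curvOp, map_smul, LinearMap.smul_apply, smul_sub])
    (fun _ _ _ => by simp only [curvOp, map_add]; abel)
    (fun _ _ _ => by simp only [curvOp, map_smul, smul_sub])
  have hC : ∀ Y Z, curvOp (fun U W => B U W) (fun U W => N U W) X Y Z = C Y Z :=
    fun _ _ => rfl
  simp only [checkR, curv, hC, ← sq, e.sum_sq_inner_left]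
  calc ∑ a, ∑ b, ‖C (e a) (e b)‖ ^ 2 = ∑ a, ∑ b, ‖C (e a) (f b)‖ ^ 2 :=
        Finset.sum_congr rfl fun a _ => e.sum_norm_sq_apply_eq f (C (e a))
    _ = ∑ b, ∑ a, ‖C.flip (f b) (e a)‖ ^ 2 := Finset.sum_comm
    _ = ∑ b, ∑ a, ‖C.flip (f b) (f a)‖ ^ 2 :=
        Finset.sum_congr rfl fun b _ => e.sum_norm_sq_apply_eq f (C.flip (f b))
    _ = _ := Finset.sum_comm

section Matrix

open Matrix

variable {κ : Type*} [Fintype κ] [DecidableEq κ]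

omit [DecidableEq κ] in
theorem Matrix.IsSymm.mulVec_dotProduct {S : Matrix κ κ ℝ} (hS : S.IsSymm) (v w : κ → ℝ) :
    (S *ᵥ v) ⬝ᵥ w = (S *ᵥ w) ⬝ᵥ v := by
  rw [dotProduct_comm, dotProduct_mulVec, ← mulVec_transpose, hS.eq]

omit [DecidableEq κ] in
theorem Matrix.mulVec_dotProduct_of_transpose_eq_neg {A : Matrix κ κ ℝ} (hA : Aᵀ = -A)
    (v w : κ → ℝ) : (A *ᵥ v) ⬝ᵥ w = -((A *ᵥ w) ⬝ᵥ v) := by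
  rw [dotProduct_comm, dotProduct_mulVec, ← mulVec_transpose, hA, neg_mulVec, neg_dotProduct]

theorem Matrix.IsSymm.eq_zero_of_isNilpotent {N : Matrix κ κ ℝ} (hN : N.IsSymm)
    (h : IsNilpotent N) : N = 0 := by
  obtain ⟨k, hk⟩ := h
  induction k with
  | zero => rw [← one_mul N, ← pow_zero N, hk, zero_mul]
  | succ k ih =>
    rcases Nat.eq_zero_or_pos k with rfl | hpos
    · simpa using hk
    · apply ih
      rw [← conjTranspose_mul_self_eq_zero, conjTranspose_eq_transpose_of_trivial,
        transpose_pow, hN.eq, ← pow_add]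
      exact pow_eq_zero_of_le (by omega) hk

/-- A normal nilpotent real matrix vanishes. -/
theorem Matrix.eq_zero_of_isNilpotent_of_normal {D : Matrix κ κ ℝ} (h : IsNilpotent D)
    (hD : Commute Dᵀ D) : D = 0 := by
  have h0 : Dᵀ * D = 0 :=
    (show (Dᵀ * D).IsSymm by simp [IsSymm, transpose_mul]).eq_zero_of_isNilpotent
      (hD.isNilpotent_mul_left h)
  rwa [← conjTranspose_eq_transpose_of_trivial, conjTranspose_mul_self_eq_zero] at h0

theorem Matrix.sum_sq_sub_smul_one (P : Matrix κ κ ℝ) (c : ℝ) :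
    ∑ i, ∑ j, (P - c • (1 : Matrix κ κ ℝ)) i j ^ 2 =
      ∑ i, ∑ j, P i j ^ 2 - 2 * c * P.trace + c ^ 2 * Fintype.card κ := by
  have h : ∀ i j, (P - c • (1 : Matrix κ κ ℝ)) i j ^ 2 =
      P i j ^ 2 - (if i = j then 2 * c * P i j else 0) + if i = j then c ^ 2 else 0 := by
    intro i j
    by_cases hij : i = j <;> simp [hij]
    ring
  simp only [h, Finset.sum_add_distrib, Finset.sum_sub_distrib, Finset.sum_ite_eq,
    Finset.mem_univ, if_true, trace, diag, Finset.mul_sum, Finset.sum_const,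
    Finset.card_univ, nsmul_eq_mul]
  ring

omit [DecidableEq κ] in
theorem Matrix.eq_zero_of_sum_sq_nonpos {P : Matrix κ κ ℝ}
    (h : ∑ i, ∑ j, P i j ^ 2 ≤ 0) : P = 0 := by
  have hrow : ∀ i ∈ Finset.univ, 0 ≤ ∑ j, P i j ^ 2 :=
    fun i _ => Finset.sum_nonneg fun j _ => sq_nonneg _
  have h' := (Finset.sum_eq_zero_iff_of_nonneg hrow).1 (le_antisymm h (Finset.sum_nonneg hrow))
  ext i j
  have hi := (Finset.sum_eq_zero_iff_of_nonneg fun j _ => sq_nonneg (P i j)).1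
    (h' i (Finset.mem_univ _))
  simpa using hi j (Finset.mem_univ _)

/-- If `S` is symmetric, the trace of the weakly Einstein condition forces `S` and `A`
to commute. -/
theorem Matrix.commute_of_trace_weaklyEinstein {S A P : Matrix κ κ ℝ} (hS : S.IsSymm)
    (hP : P = S * S + (S * A - A * S))
    (h : ∑ i, ∑ j, P i j ^ 2 + (∑ i, ∑ j, S i j ^ 2) ^ 2 - ∑ i, ∑ j, (S * S) i j ^ 2 =
      Fintype.card κ * ∑ i, ∑ j, P i j ^ 2) : Commute S A := by
  have htr : (S * S).trace = ∑ i, ∑ j, S i j ^ 2 := by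
    simp only [trace, diag, mul_apply, sq]
    exact Finset.sum_congr rfl fun i _ => Finset.sum_congr rfl fun j _ => by rw [hS.apply]
  have htrP : P.trace = ∑ i, ∑ j, S i j ^ 2 := by
    rw [hP, trace_add, trace_sub, trace_mul_comm S A, sub_self, add_zero, htr]
  rcases lt_trichotomy (Fintype.card κ) 1 with hm | hm | hm
  · have : IsEmpty κ := Fintype.card_eq_zero_iff.1 (by omega)
    ext i
    exact isEmptyElim i
  · obtain ⟨x, hx⟩ := Fintype.card_eq_one_iff.1 hm
    have : Unique κ := ⟨⟨x⟩, hx⟩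
    ext i j
    rw [Subsingleton.elim j i, mul_apply, mul_apply, Fintype.sum_unique, Fintype.sum_unique,
      Subsingleton.elim (default : κ) i, mul_comm]
  · set q := ∑ i, ∑ j, S i j ^ 2
    set m : ℝ := (Fintype.card κ : ℝ)
    have hm1 : 1 < m := Nat.one_lt_cast.2 hm
    have hq : q / m * m = q := div_mul_cancel₀ _ (by positivity)
    have hQ := sum_sq_sub_smul_one (S * S) (q / m)
    have hR := sum_sq_sub_smul_one P (q / m)
    rw [htr] at hQ
    rw [htrP] at hR
    have hQ0 : 0 ≤ ∑ i, ∑ j, (S * S - (q / m) • (1 : Matrix κ κ ℝ)) i j ^ 2 :=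
      Finset.sum_nonneg fun i _ => Finset.sum_nonneg fun j _ => sq_nonneg _
    have hR0 : 0 ≤ ∑ i, ∑ j, (P - (q / m) • (1 : Matrix κ κ ℝ)) i j ^ 2 :=
      Finset.sum_nonneg fun i _ => Finset.sum_nonneg fun j _ => sq_nonneg _
    have hsum : (m - 1) * ∑ i, ∑ j, (P - (q / m) • (1 : Matrix κ κ ℝ)) i j ^ 2 +
        ∑ i, ∑ j, (S * S - (q / m) • (1 : Matrix κ κ ℝ)) i j ^ 2 = 0 := by
      rw [hQ, hR]
      change _ + q ^ 2 - _ = _ at h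
      generalize q / m = c at hq ⊢
      rw [← hq] at h ⊢
      linear_combination -h
    have hQz := sub_eq_zero.1 (eq_zero_of_sum_sq_nonpos
      (P := S * S - (q / m) • (1 : Matrix κ κ ℝ)) (by nlinarith))
    have hPz := sub_eq_zero.1 (eq_zero_of_sum_sq_nonpos
      (P := P - (q / m) • (1 : Matrix κ κ ℝ)) (by nlinarith))
    rw [hPz, hQz, left_eq_add, sub_eq_zero] at hP
    exact hP


/-- The embedding `ℝ^κ → V` as the orthogonal complement of `f none`. -/
def hyperplaneEmb (f : OrthonormalBasis (Option κ) ℝ V) : (κ → ℝ) →ₗ[ℝ] V :=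
  Fintype.linearCombination ℝ fun i => f (some i)

section Hyperplane

variable (f : OrthonormalBasis (Option κ) ℝ V)

omit [DecidableEq κ] in
theorem hyperplaneEmb_apply (v : κ → ℝ) : hyperplaneEmb f v = ∑ i, v i • f (some i) := rfl

theorem hyperplaneEmb_single (i : κ) : hyperplaneEmb f (Pi.single i 1) = f (some i) := by
  simp [hyperplaneEmb]

theorem inner_hyperplaneEmb_some (v : κ → ℝ) (i : κ) :
    ⟪hyperplaneEmb f v, f (some i)⟫_ℝ = v i := by
  simp [hyperplaneEmb_apply, sum_inner, inner_smul_left, f.inner_eq_ite]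

theorem inner_hyperplaneEmb_none (v : κ → ℝ) : ⟪hyperplaneEmb f v, f none⟫_ℝ = 0 := by
  simp [hyperplaneEmb_apply, sum_inner, inner_smul_left, f.inner_eq_ite]

theorem inner_none_hyperplaneEmb (v : κ → ℝ) : ⟪f none, hyperplaneEmb f v⟫_ℝ = 0 := by
  rw [real_inner_comm, inner_hyperplaneEmb_none]

theorem inner_hyperplaneEmb (v w : κ → ℝ) :
    ⟪hyperplaneEmb f v, hyperplaneEmb f w⟫_ℝ = v ⬝ᵥ w := by
  rw [hyperplaneEmb_apply f w, inner_sum]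
  simp only [inner_smul_right, inner_hyperplaneEmb_some, dotProduct, mul_comm]

theorem norm_sq_hyperplaneEmb (v : κ → ℝ) : ‖hyperplaneEmb f v‖ ^ 2 = ∑ i, v i ^ 2 := by
  rw [← real_inner_self_eq_norm_sq, inner_hyperplaneEmb]
  simp only [dotProduct, sq]

omit [DecidableEq κ] in
theorem inner_none_self : ⟪f none, f none⟫_ℝ = 1 := by
  simp

theorem hyperplane_ext {x y : V} (h0 : ⟪x, f none⟫_ℝ = ⟪y, f none⟫_ℝ)
    (h : ∀ w, ⟪x, hyperplaneEmb f w⟫_ℝ = ⟪y, hyperplaneEmb f w⟫_ℝ) : x = y := by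
  refine InnerProductSpace.ext_inner_right_basis f.toBasis fun i => ?_
  rw [f.coe_toBasis]
  cases i with
  | none => exact h0
  | some i => simpa only [hyperplaneEmb_single] using h (Pi.single i 1)

end Hyperplane

/-- `B` is the bracket of `ℝ ⋉ ℝ^κ` where the unit vector `f none` acts on its orthogonal
complement by the matrix `D`. -/
structure IsSemidirectBracket (f : OrthonormalBasis (Option κ) ℝ V)
    (B : V →ₗ[ℝ] V →ₗ[ℝ] V) (D : Matrix κ κ ℝ) : Prop where
  none_none : B (f none) (f none) = 0
  none_emb : ∀ v, B (f none) (hyperplaneEmb f v) = hyperplaneEmb f (D *ᵥ v)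
  emb_none : ∀ v, B (hyperplaneEmb f v) (f none) = -hyperplaneEmb f (D *ᵥ v)
  emb_emb : ∀ v w, B (hyperplaneEmb f v) (hyperplaneEmb f w) = 0

namespace IsSemidirectBracket

variable {f : OrthonormalBasis (Option κ) ℝ V} {B N : V →ₗ[ℝ] V →ₗ[ℝ] V} {S A : Matrix κ κ ℝ}

local notation "R" => curvOp (fun U W => B U W) (fun U W => N U W)

omit [Fintype κ] [DecidableEq κ] in
theorem curvOp_swap {X Y Z : V} (hXY : B X Y = -B Y X) : R X Y Z = -R Y X Z := by
  simp only [curvOp, hXY, map_neg, LinearMap.neg_apply]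
  abel

section LeviCivita

variable (h : IsSemidirectBracket f B (S + A)) (hS : S.IsSymm) (hA : Aᵀ = -A)
  (hN : IsLeviCivita (fun U W => B U W) (fun U W => N U W))

include h hN

theorem nab_none_none : N (f none) (f none) = 0 := by
  refine hyperplane_ext f ?_ fun w => ?_
  · rw [hN]
    simp [h.none_none]
  · rw [hN]
    simp [h.none_none, h.none_emb, h.emb_none, inner_hyperplaneEmb_none]

include hS hA

theorem nab_none_emb (v : κ → ℝ) : N (f none) (hyperplaneEmb f v) = hyperplaneEmb f (A *ᵥ v) := by
  refine hyperplane_ext f ?_ fun w => ?_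
  · rw [hN]
    simp [h.none_none, h.none_emb, h.emb_none, inner_hyperplaneEmb_none]
  · rw [hN]
    simp only [h.none_emb, h.emb_none, h.emb_emb, inner_hyperplaneEmb, inner_neg_left,
      inner_zero_left, add_mulVec, add_dotProduct, hS.mulVec_dotProduct w v,
      mulVec_dotProduct_of_transpose_eq_neg hA w v]
    ring

theorem nab_emb_none (v : κ → ℝ) :
    N (hyperplaneEmb f v) (f none) = -hyperplaneEmb f (S *ᵥ v) := by
  refine hyperplane_ext f ?_ fun w => ?_
  · rw [hN]
    simp [h.none_none, h.none_emb, h.emb_none, inner_hyperplaneEmb_none]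
  · rw [hN]
    simp only [h.none_emb, h.emb_none, h.emb_emb, inner_hyperplaneEmb, inner_neg_left,
      inner_zero_left, add_mulVec, add_dotProduct, hS.mulVec_dotProduct w v,
      mulVec_dotProduct_of_transpose_eq_neg hA w v]
    ring

theorem nab_emb_emb (v w : κ → ℝ) :
    N (hyperplaneEmb f v) (hyperplaneEmb f w) = ((S *ᵥ v) ⬝ᵥ w) • f none := by
  refine hyperplane_ext f ?_ fun u => ?_
  · rw [hN]
    simp only [h.none_emb, h.emb_none, h.emb_emb, inner_hyperplaneEmb, inner_neg_left,
      inner_zero_left, add_mulVec, add_dotProduct, hS.mulVec_dotProduct w v,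
      mulVec_dotProduct_of_transpose_eq_neg hA w v, inner_smul_left, inner_none_self,
      conj_trivial]
    ring
  · rw [hN]
    simp [h.emb_emb, inner_smul_left, inner_none_hyperplaneEmb]

theorem curvOp_none_emb_none (v : κ → ℝ) :
    R (f none) (hyperplaneEmb f v) (f none) =
      hyperplaneEmb f ((S * S + (S * A - A * S)) *ᵥ v) := by
  simp only [curvOp, h.none_emb, nab_none_none h hN, nab_none_emb h hS hA hN,
    nab_emb_none h hS hA hN, map_neg, map_zero]
  simp only [← mulVec_mulVec, add_mulVec, sub_mulVec, map_add, map_sub, mulVec_add]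
  abel

theorem curvOp_none_emb_emb (v w : κ → ℝ) :
    R (f none) (hyperplaneEmb f v) (hyperplaneEmb f w) =
      -(((S * S + (S * A - A * S)) *ᵥ v) ⬝ᵥ w) • f none := by
  have hSA : (S *ᵥ v) ⬝ᵥ (A *ᵥ w) = -((A *ᵥ (S *ᵥ v)) ⬝ᵥ w) := by
    rw [mulVec_dotProduct_of_transpose_eq_neg hA, neg_neg, dotProduct_comm]
  simp only [curvOp, h.none_emb, nab_none_none h hN, nab_none_emb h hS hA hN,
    nab_emb_emb h hS hA hN, map_smul, smul_zero, zero_sub, ← neg_smul, ← sub_smul, hSA]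
  congr 1
  simp only [← mulVec_mulVec, add_mulVec, sub_mulVec, mulVec_add, add_dotProduct, sub_dotProduct]
  ring

theorem curvOp_emb_emb_none (v w : κ → ℝ) :
    R (hyperplaneEmb f v) (hyperplaneEmb f w) (f none) = 0 := by
  simp only [curvOp, h.emb_emb, nab_emb_none h hS hA hN, nab_emb_emb h hS hA hN, map_neg,
    map_zero, LinearMap.zero_apply, dotProduct_comm (S *ᵥ v)]
  abel

theorem curvOp_emb_emb_emb (u v w : κ → ℝ) :
    R (hyperplaneEmb f u) (hyperplaneEmb f v) (hyperplaneEmb f w) =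
      hyperplaneEmb f (((S *ᵥ u) ⬝ᵥ w) • (S *ᵥ v) - ((S *ᵥ v) ⬝ᵥ w) • (S *ᵥ u)) := by
  simp only [curvOp, h.emb_emb, nab_emb_none h hS hA hN, nab_emb_emb h hS hA hN,
    map_zero, LinearMap.zero_apply, map_smul, map_sub, smul_neg]
  abel

theorem checkR_none [FiniteDimensional ℝ V] {ι : Type*} [Fintype ι]
    (e : OrthonormalBasis ι ℝ V) :
    checkR (fun U W => B U W) (fun U W => N U W) e (f none) (f none) =
      2 * ∑ i, ∑ j, (S * S + (S * A - A * S)) i j ^ 2 := by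
  have h0 : ∀ Z, R (f none) (f none) Z = 0 := fun Z => by simp [curvOp, h.none_none]
  have hcol : ∑ j, ∑ i, (S * S + (S * A - A * S)) i j ^ 2 =
      ∑ i, ∑ j, (S * S + (S * A - A * S)) i j ^ 2 := Finset.sum_comm
  rw [checkR_self_eq B N e f]
  simp only [Fintype.sum_option, h0, ← hyperplaneEmb_single f, curvOp_none_emb_none h hS hA hN,
    curvOp_none_emb_emb h hS hA hN, norm_sq_hyperplaneEmb, norm_smul, norm_neg, mul_pow,
    f.norm_eq_one, mulVec_single_one, dotProduct_single_one, Real.norm_eq_abs, sq_abs, col_apply,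
    Finset.sum_add_distrib]
  generalize S * S + (S * A - A * S) = P at hcol ⊢
  simp only [norm_zero, ne_eq, OfNat.ofNat_ne_zero, not_false_eq_true, zero_pow,
    Finset.sum_const_zero, zero_add, one_pow, mul_one, hcol]
  ring

theorem checkR_some [FiniteDimensional ℝ V] {ι : Type*} [Fintype ι]
    (e : OrthonormalBasis ι ℝ V) (i : κ) :
    checkR (fun U W => B U W) (fun U W => N U W) e (f (some i)) (f (some i)) =
      2 * ∑ j, (S * S + (S * A - A * S)) j i ^ 2 +
        ∑ a, ∑ b, ∑ c, (S b i * S c a - S b a * S c i) ^ 2 := by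
  have h0 : ∀ Z, R (hyperplaneEmb f (Pi.single i 1)) (f none) Z =
      -R (f none) (hyperplaneEmb f (Pi.single i 1)) Z :=
    fun Z => curvOp_swap (by rw [h.emb_none, h.none_emb])
  rw [checkR_self_eq B N e f]
  simp only [Fintype.sum_option, ← hyperplaneEmb_single f, h0, curvOp_none_emb_none h hS hA hN,
    curvOp_none_emb_emb h hS hA hN, curvOp_emb_emb_none h hS hA hN,
    curvOp_emb_emb_emb h hS hA hN, norm_sq_hyperplaneEmb, norm_smul, norm_neg, mul_pow,
    f.norm_eq_one, mulVec_single_one, dotProduct_single_one, Real.norm_eq_abs, sq_abs, col_apply,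
    Pi.sub_apply, Pi.smul_apply, smul_eq_mul]
  simp
  ring

end LeviCivita
end IsSemidirectBracket

omit [DecidableEq κ] in
theorem Matrix.sum_sq_wedge_eq {S : Matrix κ κ ℝ} (hS : S.IsSymm) :
    ∑ i, ∑ a, ∑ b, ∑ c, (S b i * S c a - S b a * S c i) ^ 2 =
      2 * (∑ i, ∑ j, S i j ^ 2) ^ 2 - 2 * ∑ i, ∑ j, (S * S) i j ^ 2 := by
  have hrow : ∀ i a, ∑ b, ∑ c, (S b i * S c a - S b a * S c i) ^ 2 =
      2 * ((∑ b, S i b ^ 2) * ∑ c, S a c ^ 2) - 2 * (S * S) i a ^ 2 := by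
    intro i a
    have h1 : (S * S) i a = ∑ b, S i b * S a b := by
      rw [mul_apply]
      exact Finset.sum_congr rfl fun b _ => by rw [hS.apply b a]
    have h2 : ∀ b c, (S b i * S c a - S b a * S c i) ^ 2 =
        S i b ^ 2 * S a c ^ 2 + S a b ^ 2 * S i c ^ 2 -
          2 * (S i b * S a b * (S i c * S a c)) := by
      intro b c
      rw [hS.apply i b, hS.apply a c, hS.apply a b, hS.apply i c]
      ring
    simp only [h2, Finset.sum_sub_distrib, Finset.sum_add_distrib, ← Finset.mul_sum,
      ← Finset.sum_mul, h1]
    ring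
  simp only [hrow, Finset.sum_sub_distrib, ← Finset.mul_sum, ← Finset.sum_mul]
  ring

theorem IsSemidirectBracket.eq_zero_of_weaklyEinstein [FiniteDimensional ℝ V]
    {ι : Type*} [Fintype ι] {e : OrthonormalBasis ι ℝ V}
    {f : OrthonormalBasis (Option κ) ℝ V} {B N : V →ₗ[ℝ] V →ₗ[ℝ] V} {D : Matrix κ κ ℝ}
    (h : IsSemidirectBracket f B D) (hD : IsNilpotent D)
    (hN : IsLeviCivita (fun U W => B U W) (fun U W => N U W))
    (hW : WeaklyEinstein (fun U W => B U W) (fun U W => N U W) e) : D = 0 := by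
  obtain ⟨S, hSdef⟩ : ∃ S : Matrix κ κ ℝ, S = (1 / 2 : ℝ) • (D + Dᵀ) := ⟨_, rfl⟩
  obtain ⟨A, hAdef⟩ : ∃ A : Matrix κ κ ℝ, A = (1 / 2 : ℝ) • (D - Dᵀ) := ⟨_, rfl⟩
  have hS : S.IsSymm := by
    rw [IsSymm, hSdef, transpose_smul, transpose_add, transpose_transpose, add_comm]
  have hA : Aᵀ = -A := by
    rw [hAdef, transpose_smul, transpose_sub, transpose_transpose, ← smul_neg, neg_sub]
  have hSA : D = S + A := by
    rw [hSdef, hAdef]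
    module
  subst hSA
  have hdiag : ∀ i, 2 * ∑ j, (S * S + (S * A - A * S)) j i ^ 2 +
        ∑ a, ∑ b, ∑ c, (S b i * S c a - S b a * S c i) ^ 2 =
      2 * ∑ i, ∑ j, (S * S + (S * A - A * S)) i j ^ 2 := by
    intro i
    rw [← h.checkR_some hS hA hN e, ← h.checkR_none hS hA hN e, hW, hW (f none)]
    simp
  have hsum := Finset.sum_congr (rfl : Finset.univ = Finset.univ) fun i _ => hdiag i
  rw [Finset.sum_add_distrib, sum_sq_wedge_eq hS, ← Finset.mul_sum, Finset.sum_comm,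
    Finset.sum_const, Finset.card_univ, nsmul_eq_mul] at hsum
  have hcomm : Commute S A := commute_of_trace_weaklyEinstein hS rfl (by linarith)
  refine eq_zero_of_isNilpotent_of_normal hD ?_
  rw [transpose_add, hS.eq, hA, ← sub_eq_add_neg]
  exact ((Commute.refl S).add_right hcomm).sub_left (hcomm.symm.add_right (Commute.refl A))

end Matrix

theorem IsLieBracket.exists_linear {br : V → V → V} (hbr : IsLieBracket br) :
    ∃ B : V →ₗ[ℝ] V →ₗ[ℝ] V, br = fun U W => B U W := by
  refine ⟨LinearMap.mk₂ ℝ br hbr.add_left hbr.smul_left (fun X Y Z => ?_) (fun c X Y => ?_), rfl⟩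
  · rw [hbr.antisymm, hbr.add_left, hbr.antisymm Y, hbr.antisymm Z]
    abel
  · rw [hbr.antisymm, hbr.smul_left, hbr.antisymm Y, smul_neg, neg_neg]

theorem IsLeviCivita.exists_linear {B : V →ₗ[ℝ] V →ₗ[ℝ] V} {nab : V → V → V}
    (h : IsLeviCivita (fun U W => B U W) nab) :
    ∃ N : V →ₗ[ℝ] V →ₗ[ℝ] V, nab = fun U W => N U W := by
  refine ⟨LinearMap.mk₂ ℝ nab ?_ ?_ ?_ ?_, rfl⟩ <;> intro X Y Z <;>
    refine ext_inner_right ℝ fun W => ?_ <;>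
    simp only [h _ _ _, inner_add_left, inner_add_right, inner_smul_left, inner_smul_right,
      map_add, map_smul, LinearMap.add_apply, LinearMap.smul_apply, conj_trivial] <;> ring

/-- A hyperplane is spanned by all but one vector of some orthonormal basis. -/
theorem exists_orthonormalBasis_option_s5 [FiniteDimensional ℝ V] (𝔞 : Submodule ℝ V)
    (hcodim : finrank ℝ 𝔞 + 1 = finrank ℝ V) :
    ∃ f : OrthonormalBasis (Option (Fin (finrank ℝ 𝔞))) ℝ V,
      ∀ x, x ∈ 𝔞 ↔ ∃ v, x = hyperplaneEmb f v := by
  let b := stdOrthonormalBasis ℝ 𝔞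
  let v : Option (Fin (finrank ℝ 𝔞)) → V := fun o => o.elim 0 fun i => (b i : V)
  have hv : Orthonormal ℝ ((Set.range some).domRestrict v) := by
    constructor
    · rintro ⟨_, i, rfl⟩
      exact b.norm_eq_one i
    · rintro ⟨_, i, rfl⟩ ⟨_, j, rfl⟩ hij
      exact b.inner_eq_zero fun h => hij (by rw [h])
  obtain ⟨f, hf⟩ := hv.exists_orthonormalBasis_extension_of_card_eq (by simp [hcodim])
  have hfb : ∀ i, f (some i) = b i := fun i => hf (some i) ⟨i, rfl⟩
  refine ⟨f, fun x => ⟨fun hx => ⟨fun i => b.repr ⟨x, hx⟩ i, ?_⟩, ?_⟩⟩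
  · have := congrArg (fun y : 𝔞 => (y : V)) (b.sum_repr ⟨x, hx⟩)
    simpa [hyperplaneEmb_apply, hfb] using this.symm
  · rintro ⟨v, rfl⟩
    rw [hyperplaneEmb_apply]
    exact 𝔞.sum_mem fun i _ => 𝔞.smul_mem _ (hfb i ▸ (b i).2)

section Semidirect

open Matrix

variable {κ : Type*} [Fintype κ] [DecidableEq κ]

theorem exists_isSemidirectBracket {B : V →ₗ[ℝ] V →ₗ[ℝ] V}
    (hB : IsLieBracket fun U W => B U W) {𝔞 : Submodule ℝ V}
    (habelian : ∀ X Y : V, X ∈ 𝔞 → Y ∈ 𝔞 → B X Y = 0)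
    (hideal : ∀ X Y : V, Y ∈ 𝔞 → B X Y ∈ 𝔞)
    {f : OrthonormalBasis (Option κ) ℝ V} (hf : ∀ x, x ∈ 𝔞 ↔ ∃ v, x = hyperplaneEmb f v) :
    ∃ D : Matrix κ κ ℝ, IsSemidirectBracket f B D := by
  have hmem : ∀ v, hyperplaneEmb f v ∈ 𝔞 := fun v => (hf _).2 ⟨v, rfl⟩
  choose d hd using fun j => (hf _).1 (hideal (f none) _ (hmem (Pi.single j 1)))
  have hD : ∀ v, B (f none) (hyperplaneEmb f v) =
      hyperplaneEmb f ((Matrix.of fun i j => d j i) *ᵥ v) := by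
    intro v
    have hv : (Matrix.of fun i j => d j i) *ᵥ v = ∑ j, v j • d j := by
      ext i
      simp [mulVec, dotProduct, mul_comm]
    rw [hv, hyperplaneEmb_apply f v, map_sum, map_sum]
    refine Finset.sum_congr rfl fun j _ => ?_
    rw [map_smul, map_smul, ← hd, hyperplaneEmb_single]
  have hself : B (f none) (f none) = 0 := by
    have h2 := hB.antisymm (f none) (f none)
    rwa [eq_neg_iff_add_eq_zero, ← two_smul ℝ, smul_eq_zero_iff_right two_ne_zero] at h2
  exact ⟨_, hself, hD,
    fun v => by rw [← hD]; exact hB.antisymm _ _,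
    fun v w => habelian _ _ (hmem v) (hmem w)⟩

namespace IsSemidirectBracket

variable {f : OrthonormalBasis (Option κ) ℝ V} {B : V →ₗ[ℝ] V →ₗ[ℝ] V}

theorem isNilpotent {D : Matrix κ κ ℝ} (h : IsSemidirectBracket f B D)
    (hB : IsNilpotentBracket fun U W => B U W) : IsNilpotent D := by
  obtain ⟨k, hk⟩ := hB
  have hpow : ∀ (l : ℕ) (v : κ → ℝ),
      (List.replicate l (f none)).foldr (fun U W => B U W) (hyperplaneEmb f v) =
        hyperplaneEmb f ((D ^ l) *ᵥ v) := by
    intro l v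
    induction l with
    | zero => simp
    | succ l ih =>
      rw [List.replicate_succ, List.foldr_cons, ih, h.none_emb, mulVec_mulVec, pow_succ']
  refine ⟨k, ?_⟩
  ext i j
  have hz := hk (fun _ => f none) (hyperplaneEmb f (Pi.single j 1))
  rw [List.ofFn_const, hpow, mulVec_single_one] at hz
  have := inner_hyperplaneEmb_some f ((D ^ k).col j) i
  rw [hz, inner_zero_left] at this
  exact this.symm

theorem eq_zero (h : IsSemidirectBracket f B 0) : B = 0 := by
  refine f.toBasis.ext fun i => f.toBasis.ext fun j => ?_
  rw [f.coe_toBasis]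
  rcases i with _ | i <;> rcases j with _ | j
  · simp [h.none_none]
  · rw [← hyperplaneEmb_single f, h.none_emb, zero_mulVec]
    simp
  · rw [← hyperplaneEmb_single f, h.emb_none, zero_mulVec]
    simp
  · simp [← hyperplaneEmb_single f, h.emb_emb]

end IsSemidirectBracket

end Semidirect

/-- A nilpotent, non-abelian metric Lie algebra containing an
abelian ideal of codimension 1 is not weakly Einstein. -/
theorem nilpotent_almostAbelian_not_weaklyEinstein
    {V : Type*} [NormedAddCommGroup V] [InnerProductSpace ℝ V] [FiniteDimensional ℝ V]
    (br : V → V → V) (hbr : IsLieBracket br)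
    (hnilp : IsNilpotentBracket br)
    (hnonab : ∃ X Y : V, br X Y ≠ 0)
    (𝔞 : Submodule ℝ V)
    (hcodim : finrank ℝ 𝔞 + 1 = finrank ℝ V)
    (habelian : ∀ X Y : V, X ∈ 𝔞 → Y ∈ 𝔞 → br X Y = 0)
    (hideal : ∀ X Y : V, Y ∈ 𝔞 → br X Y ∈ 𝔞)
    (nab : V → V → V) (hnab : IsLeviCivita br nab)
    {ι : Type*} [Fintype ι] (e : OrthonormalBasis ι ℝ V) :
    ¬ WeaklyEinstein br nab e := by
  obtain ⟨B, rfl⟩ : ∃ B : V →ₗ[ℝ] V →ₗ[ℝ] V, br = fun U W => B U W := hbr.exists_linear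
  obtain ⟨N, rfl⟩ : ∃ N : V →ₗ[ℝ] V →ₗ[ℝ] V, nab = fun U W => N U W := hnab.exists_linear
  intro hW
  obtain ⟨f, hf⟩ := exists_orthonormalBasis_option_s5 𝔞 hcodim
  obtain ⟨D, h⟩ := exists_isSemidirectBracket hbr habelian hideal hf
  have hD := h.isNilpotent hnilp
  obtain rfl := h.eq_zero_of_weaklyEinstein hD hnab hW
  obtain ⟨X, Y, hXY⟩ := hnonab
  exact hXY (by simp [h.eq_zero])
end
end

section
/- Let (𝔫,⟨·,·⟩) be a metric Lie algebra which is 2-step nilpotent and non-abelian, i.e., [𝔫,𝔫] ≠ 0 and [[𝔫,𝔫],𝔫] = 0. Then (𝔫,⟨·,·⟩) is not weakly Einstein. -/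
open Module
open scoped InnerProductSpace BigOperators

noncomputable section

variable {V : Type*} [NormedAddCommGroup V] [InnerProductSpace ℝ V]

section TwoStep

variable {B J : V →ₗ[ℝ] V →ₗ[ℝ] V}

theorem IsLieBracket.exists_linearMap {br : V → V → V} (hbr : IsLieBracket br) :
    ∃ B : V →ₗ[ℝ] V →ₗ[ℝ] V, ∀ X Y, B X Y = br X Y := by
  refine ⟨LinearMap.mk₂ ℝ br hbr.add_left hbr.smul_left ?_ ?_, fun X Y => rfl⟩
  · intro X Y Z
    rw [hbr.antisymm X, hbr.add_left, hbr.antisymm Y X, hbr.antisymm Z X]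
    abel
  · intro c X Y
    rw [hbr.antisymm X, hbr.smul_left, hbr.antisymm Y X, smul_neg, neg_neg]

/-- The maps `J z` with `⟪J z x, y⟫ = ⟪[x, y], z⟫`. -/
theorem exists_bracket_adjoint {ι : Type*} [Fintype ι] (e : OrthonormalBasis ι ℝ V)
    (B : V →ₗ[ℝ] V →ₗ[ℝ] V) :
    ∃ J : V →ₗ[ℝ] V →ₗ[ℝ] V, ∀ z x y, ⟪J z x, y⟫_ℝ = ⟪B x y, z⟫_ℝ := by
  refine ⟨LinearMap.mk₂ ℝ (fun z x => ∑ a, ⟪B x (e a), z⟫_ℝ • e a) ?_ ?_ ?_ ?_, ?_⟩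
  · intro z z' x
    simp [inner_add_right, add_smul, Finset.sum_add_distrib]
  · intro c z x
    simp [inner_smul_right, mul_smul, Finset.smul_sum]
  · intro z x x'
    simp [inner_add_left, add_smul, Finset.sum_add_distrib]
  · intro c z x
    simp [inner_smul_left, mul_smul, Finset.smul_sum]
  · intro z x y
    conv_rhs => rw [← e.sum_repr' y]
    simp [sum_inner, inner_smul_left, mul_comm]

theorem nab_eq {br nab : V → V → V} (hB : ∀ X Y, B X Y = br X Y)
    (hanti : ∀ X Y, B X Y = - B Y X)
    (hJ : ∀ z x y, ⟪J z x, y⟫_ℝ = ⟪B x y, z⟫_ℝ) (hnab : IsLeviCivita br nab) (U W : V) :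
    nab U W = (1 / 2 : ℝ) • (B U W - J U W - J W U) := by
  refine ext_inner_right ℝ fun Z => ?_
  rw [hnab, ← hB, ← hB, ← hB, hanti Z U]
  simp only [inner_smul_left, inner_sub_left, hJ, inner_neg_left]
  simp
  ring

theorem four_mul_curv {br nab : V → V → V} (hB : ∀ X Y, B X Y = br X Y)
    (hanti : ∀ X Y, B X Y = - B Y X) (h2 : ∀ X Y Z, B (B X Y) Z = 0)
    (hJ : ∀ z x y, ⟪J z x, y⟫_ℝ = ⟪B x y, z⟫_ℝ) (hnab : IsLeviCivita br nab)
    (X Y Z W : V) :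
    4 * curv br nab X Y Z W =
      - ⟪B X W, B Y Z⟫_ℝ + ⟪B Y W, B X Z⟫_ℝ + 2 * ⟪B X Y, B Z W⟫_ℝ
      - ⟪J X W + J W X, J Y Z + J Z Y⟫_ℝ + ⟪J Y W + J W Y, J X Z + J Z X⟫_ℝ := by
  have h2' : ∀ X Y Z, B X (B Y Z) = 0 := fun X Y Z => by rw [hanti, h2, neg_zero]
  have hJB : ∀ u p q, J u (B p q) = 0 := fun u p q =>
    ext_inner_right ℝ fun v => by rw [hJ, h2]; simp
  have hJJ : ∀ p q, J (J p q) = 0 := fun p q => by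
    ext v
    refine ext_inner_right ℝ fun w => ?_
    rw [hJ, real_inner_comm, hJ, h2']; simp
  have hskew : ∀ z x y, ⟪J z x, y⟫_ℝ = - ⟪J z y, x⟫_ℝ := fun z x y => by
    rw [hJ, hJ, hanti, inner_neg_left]
  have hBJ : ∀ x u w, ⟪B x u, w⟫_ℝ = ⟪J w x, u⟫_ℝ := fun x u w => (hJ _ _ _).symm
  have e1 : ∀ x p q, ⟪J (B p q) x, W⟫_ℝ = ⟪B x W, B p q⟫_ℝ := fun x p q => hJ _ _ _
  simp only [curv, curvOp, ← hB, nab_eq hB hanti hJ hnab, map_smul, map_sub, hJB, hJJ, h2, h2',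
    LinearMap.sub_apply, LinearMap.smul_apply, LinearMap.zero_apply]
  simp only [inner_sub_left, inner_smul_left, inner_add_left, inner_add_right, e1, inner_zero_left]
  simp only [hskew X (J _ _) W, hskew Y (J _ _) W, hBJ X (J _ _), hBJ Y (J _ _),
    real_inner_comm (B X Z), real_inner_comm (B Y Z), real_inner_comm (B Z W)]
  simp
  ring

theorem OrthonormalBasis.sum_sq_inner {ι : Type*} [Fintype ι] (e : OrthonormalBasis ι ℝ V)
    (x : V) : ∑ a, ⟪x, e a⟫_ℝ ^ 2 = ⟪x, x⟫_ℝ := by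
  rw [← e.sum_inner_mul_inner x x]
  exact Finset.sum_congr rfl fun a _ => by rw [sq, real_inner_comm x]

theorem OrthonormalBasis.sum_sq_linear_eq {ι κ : Type*} [Fintype ι] [Fintype κ]
    (e : OrthonormalBasis ι ℝ V) (f : OrthonormalBasis κ ℝ V) {φ : V → ℝ}
    (hφ : IsLinearMap ℝ φ) : ∑ a, φ (e a) ^ 2 = ∑ a, φ (f a) ^ 2 := by
  obtain ⟨w, hw⟩ : ∃ w, ∀ x, φ x = ⟪w, x⟫_ℝ := by
    refine ⟨∑ a, φ (e a) • e a, fun x => ?_⟩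
    have h : hφ.mk' φ x = _ := congrArg _ (e.sum_repr' x).symm
    simp only [map_sum, map_smul, IsLinearMap.mk'_apply] at h
    rw [h, sum_inner]
    exact Finset.sum_congr rfl fun a _ => by rw [real_inner_smul_left, smul_eq_mul, mul_comm]
  simp only [hw]
  rw [e.sum_sq_inner, f.sum_sq_inner]

theorem OrthonormalBasis.sum_sq_trilinear_eq {ι κ : Type*} [Fintype ι] [Fintype κ]
    (e : OrthonormalBasis ι ℝ V) (f : OrthonormalBasis κ ℝ V) {T : V → V → V → ℝ}
    (h₁ : ∀ y z, IsLinearMap ℝ fun x => T x y z) (h₂ : ∀ x z, IsLinearMap ℝ fun y => T x y z)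
    (h₃ : ∀ x y, IsLinearMap ℝ fun z => T x y z) :
    ∑ a, ∑ b, ∑ c, T (e a) (e b) (e c) ^ 2 = ∑ a, ∑ b, ∑ c, T (f a) (f b) (f c) ^ 2 := by
  calc ∑ a, ∑ b, ∑ c, T (e a) (e b) (e c) ^ 2
      = ∑ a, ∑ b, ∑ c, T (e a) (e b) (f c) ^ 2 := by
        refine Finset.sum_congr rfl fun a _ => Finset.sum_congr rfl fun b _ => ?_
        exact e.sum_sq_linear_eq f (h₃ _ _)
    _ = ∑ a, ∑ c, ∑ b, T (e a) (f b) (f c) ^ 2 := by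
        refine Finset.sum_congr rfl fun a _ => ?_
        rw [Finset.sum_comm]
        exact Finset.sum_congr rfl fun c _ => e.sum_sq_linear_eq f (h₂ _ _)
    _ = ∑ c, ∑ b, ∑ a, T (f a) (f b) (f c) ^ 2 := by
        rw [Finset.sum_comm]
        refine Finset.sum_congr rfl fun c _ => ?_
        rw [Finset.sum_comm]
        exact Finset.sum_congr rfl fun b _ =>
          e.sum_sq_linear_eq f (φ := fun x => T x (f b) (f c)) (h₁ _ _)
    _ = _ := by
        rw [Finset.sum_comm]
        simp_rw [fun b => Finset.sum_comm (s := Finset.univ) (t := Finset.univ)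
          (f := fun c a => T (f a) (f b) (f c) ^ 2)]
        rw [Finset.sum_comm]

theorem exists_orthonormalBasis_mem_or_mem_orthogonal [FiniteDimensional ℝ V]
    (Z : Submodule ℝ V) :
    ∃ (n : ℕ) (f : OrthonormalBasis (Fin n) ℝ V), ∀ a, f a ∈ Z ∨ f a ∈ Zᗮ := by
  let b := ((stdOrthonormalBasis ℝ Z).prod (stdOrthonormalBasis ℝ Zᗮ)).map
    Z.orthogonalDecomposition.symm
  refine ⟨_, b.reindex (Fintype.equivFin _), fun a => ?_⟩
  rw [OrthonormalBasis.reindex_apply]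
  rcases (Fintype.equivFin _).symm a with i | i
  · left; simp [b]
  · right; simp [b]

theorem sum_sq_curv_eq {br nab : V → V → V} (hB : ∀ X Y, B X Y = br X Y)
    (hanti : ∀ X Y, B X Y = - B Y X) (h2 : ∀ X Y Z, B (B X Y) Z = 0)
    (hJ : ∀ z x y, ⟪J z x, y⟫_ℝ = ⟪B x y, z⟫_ℝ) (hnab : IsLeviCivita br nab)
    {ι κ : Type*} [Fintype ι] [Fintype κ]
    (e : OrthonormalBasis ι ℝ V) (f : OrthonormalBasis κ ℝ V) (X : V) :
    ∑ a, ∑ b, ∑ c, curv br nab X (e a) (e b) (e c) ^ 2 =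
      ∑ a, ∑ b, ∑ c, curv br nab X (f a) (f b) (f c) ^ 2 := by
  have key := fun Y Z W => four_mul_curv hB hanti h2 hJ hnab X Y Z W
  refine e.sum_sq_trilinear_eq f (T := fun Y Z W => curv br nab X Y Z W) ?_ ?_ ?_ <;>
  · refine fun p q => ⟨fun u v => ?_, fun r u => ?_⟩ <;>
    · refine mul_left_cancel₀ (four_ne_zero (α := ℝ)) ?_
      simp only [mul_add, smul_eq_mul, mul_left_comm (4 : ℝ), key]
      simp only [map_add, map_smul, LinearMap.add_apply, LinearMap.smul_apply, inner_add_left,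
        inner_add_right, real_inner_smul_left, real_inner_smul_right]
      ring

theorem sum_swap_right {ι : Type*} [Fintype ι] (g : ι → ι → ι → ℝ) :
    ∑ a, ∑ b, ∑ c, g a c b = ∑ a, ∑ b, ∑ c, g a b c :=
  Finset.sum_congr rfl fun _ _ => Finset.sum_comm

theorem sum_swap_left {ι : Type*} [Fintype ι] (g : ι → ι → ι → ℝ) :
    ∑ a, ∑ b, ∑ c, g b a c = ∑ a, ∑ b, ∑ c, g a b c :=
  Finset.sum_comm

theorem sum_rotate {ι : Type*} [Fintype ι] (g : ι → ι → ι → ℝ) :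
    ∑ a, ∑ b, ∑ c, g c a b = ∑ a, ∑ b, ∑ c, g a b c := by
  rw [← sum_swap_left g, ← sum_swap_right]

theorem sum_rotate' {ι : Type*} [Fintype ι] (g : ι → ι → ι → ℝ) :
    ∑ a, ∑ b, ∑ c, g b c a = ∑ a, ∑ b, ∑ c, g a b c :=
  (sum_rotate fun a b c => g b c a).symm

theorem sum_reverse {ι : Type*} [Fintype ι] (g : ι → ι → ι → ℝ) :
    ∑ a, ∑ b, ∑ c, g c b a = ∑ a, ∑ b, ∑ c, g a b c := by
  rw [← sum_swap_left g, ← sum_rotate]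

theorem sum_swap_pairs {ι κ : Type*} [Fintype ι] [Fintype κ] (g : ι → ι → κ → κ → ℝ) :
    ∑ a, ∑ b, ∑ c, ∑ d, g a b c d = ∑ c, ∑ d, ∑ a, ∑ b, g a b c d := by
  calc _ = ∑ a, ∑ c, ∑ b, ∑ d, g a b c d := Finset.sum_congr rfl fun _ _ => Finset.sum_comm
    _ = ∑ c, ∑ a, ∑ d, ∑ b, g a b c d := by
      rw [Finset.sum_comm]
      exact Finset.sum_congr rfl fun _ _ => Finset.sum_congr rfl fun _ _ => Finset.sum_comm
    _ = _ := Finset.sum_congr rfl fun _ _ => Finset.sum_comm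

theorem sum_sq_nonneg {ι : Type*} [Fintype ι] (g : ι → ι → ι → ι → ι → ℝ) :
    0 ≤ ∑ a, ∑ b, ∑ c, ∑ d, ∑ e, g a b c d e ^ 2 :=
  Finset.sum_nonneg fun _ _ => Finset.sum_nonneg fun _ _ => Finset.sum_nonneg fun _ _ =>
    Finset.sum_nonneg fun _ _ => Finset.sum_nonneg fun _ _ => sq_nonneg _

theorem eq_zero_of_sum_sq_nonpos {ι : Type*} [Fintype ι] {g : ι → ι → ι → ι → ι → ℝ}
    (h : ∑ a, ∑ b, ∑ c, ∑ d, ∑ e, g a b c d e ^ 2 ≤ 0) (a b c d e : ι) : g a b c d e = 0 := by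
  have h' : ∑ p : ι × ι × ι × ι × ι, g p.1 p.2.1 p.2.2.1 p.2.2.2.1 p.2.2.2.2 ^ 2 ≤ 0 := by
    simpa only [Fintype.sum_prod_type] using h
  have h0 := (Finset.sum_eq_zero_iff_of_nonneg fun p _ => sq_nonneg _).1
    (le_antisymm h' (Finset.sum_nonneg fun p _ => sq_nonneg _)) (a, b, c, d, e) (Finset.mem_univ _)
  exact sq_eq_zero_iff.1 h0

theorem sum_sq_curv_of_central {br nab : V → V → V} (hB : ∀ X Y, B X Y = br X Y)
    (hanti : ∀ X Y, B X Y = - B Y X) (h2 : ∀ X Y Z, B (B X Y) Z = 0)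
    (hJ : ∀ z x y, ⟪J z x, y⟫_ℝ = ⟪B x y, z⟫_ℝ) (hnab : IsLeviCivita br nab)
    {ι : Type*} [Fintype ι] {f : ι → V}
    (hf : ∀ a, J (f a) = 0 ∨ ((∀ u, J u (f a) = 0) ∧ B (f a) = 0))
    {z : V} (hz : B z = 0) (hz' : ∀ u, J u z = 0) :
    16 * ∑ a, ∑ b, ∑ c, curv br nab z (f a) (f b) (f c) ^ 2 =
      6 * ∑ a, ∑ b, ∑ c, ⟪J (f a) (f b), J z (f c)⟫_ℝ ^ 2 -
      ∑ a, ∑ b, ∑ c,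
        (⟪J (f a) (f b), J z (f c)⟫_ℝ + ⟪J (f a) (f c), J z (f b)⟫_ℝ) ^ 2 := by
  set α : ι → ι → ι → ℝ := fun a b c => ⟪J (f a) (f b), J z (f c)⟫_ℝ with hα
  have pt : ∀ a b c, 16 * curv br nab z (f a) (f b) (f c) ^ 2 =
      2 * α a b c ^ 2 + 2 * α a c b ^ 2 - (α a b c + α a c b) ^ 2
        + α c a b ^ 2 + α b a c ^ 2 := fun a b c => by
    have h4 : 4 * curv br nab z (f a) (f b) (f c) =
        - α a b c - α b a c + α a c b + α c a b := by
      rw [four_mul_curv hB hanti h2 hJ hnab]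
      simp only [hα, hz, hz', LinearMap.zero_apply, inner_zero_left, inner_zero_right, add_zero,
        inner_add_left, inner_add_right, real_inner_comm (J z (f c))]
      ring
    rw [show (16 : ℝ) * curv br nab z (f a) (f b) (f c) ^ 2 =
      (4 * curv br nab z (f a) (f b) (f c)) ^ 2 by ring, h4]
    have z1 : α a b c * α b a c = 0 := by
      rcases hf a with h | ⟨h, -⟩ <;> simp [hα, h]
    have z2 : α a b c * α c a b = 0 := by
      rcases hf a with h | ⟨h, -⟩ <;> simp [hα, h]
    have z3 : α b a c * α a c b = 0 := by
      rcases hf a with h | ⟨h, -⟩ <;> simp [hα, h]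
    have z4 : α b a c * α c a b = 0 := by
      rcases hf b with h | ⟨h, -⟩ <;> simp [hα, h]
    have z5 : α a c b * α c a b = 0 := by
      rcases hf a with h | ⟨h, -⟩ <;> simp [hα, h]
    linear_combination 2 * z1 - 2 * z2 - 2 * z3 - 2 * z4 + 2 * z5
  change _ = 6 * ∑ a, ∑ b, ∑ c, α a b c ^ 2 - ∑ a, ∑ b, ∑ c, (α a b c + α a c b) ^ 2
  simp only [Finset.mul_sum, pt, Finset.sum_add_distrib, Finset.sum_sub_distrib]
  simp only [← Finset.mul_sum]
  rw [sum_swap_right fun a b c => α a b c ^ 2, sum_rotate fun a b c => α a b c ^ 2,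
    sum_swap_left fun a b c => α a b c ^ 2]
  ring

theorem sum_inner_bracket_mul_eq
    (hJ : ∀ z x y, ⟪J z x, y⟫_ℝ = ⟪B x y, z⟫_ℝ)
    (hskew : ∀ z x y, ⟪J z x, y⟫_ℝ = - ⟪J z y, x⟫_ℝ)
    {ι : Type*} [Fintype ι] (f : OrthonormalBasis ι ℝ V) (x : V) :
    ∑ a, ∑ b, ∑ c, ⟪B x (f a), B (f b) (f c)⟫_ℝ * ⟪B x (f b), B (f a) (f c)⟫_ℝ =
      ∑ a, ∑ b, ∑ c, ⟪J (f a) x, J (f b) (f c)⟫_ℝ * ⟪J (f b) x, J (f a) (f c)⟫_ℝ := by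
  have expand : ∀ v : V, v = ∑ k, ⟪v, f k⟫_ℝ • f k := fun v => by
    conv_lhs => rw [← f.sum_repr' v]
    simp only [real_inner_comm v]
  have hl : ∀ a b, ∑ c, ⟪B x (f a), B (f b) (f c)⟫_ℝ * ⟪B x (f b), B (f a) (f c)⟫_ℝ =
      ∑ k, ∑ l, ⟪J (f k) x, f a⟫_ℝ * ⟪J (f l) x, f b⟫_ℝ * ⟪J (f k) (f b), J (f l) (f a)⟫_ℝ := by
    intro a b
    have : ∀ u v w : V, ⟪u, B v w⟫_ℝ = ⟪J u v, w⟫_ℝ := fun u v w => by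
      rw [hJ, real_inner_comm]
    simp only [this]
    rw [Finset.sum_congr rfl fun c _ => by rw [real_inner_comm (f c) (J (B x (f b)) (f a))],
      f.sum_inner_mul_inner]
    conv_lhs => rw [expand (B x (f a)), expand (B x (f b))]
    simp only [map_sum, map_smul, LinearMap.sum_apply, LinearMap.smul_apply, sum_inner, inner_sum,
      real_inner_smul_left, real_inner_smul_right, hJ _ x, mul_assoc]
    rw [Finset.sum_comm]
    refine Finset.sum_congr rfl fun k _ => Finset.sum_congr rfl fun l _ => ?_
    ring
  have hr : ∀ k l, ∑ c, ⟪J (f k) x, J (f l) (f c)⟫_ℝ * ⟪J (f l) x, J (f k) (f c)⟫_ℝ =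
      ∑ a, ∑ b, ⟪J (f k) x, f a⟫_ℝ * ⟪J (f l) x, f b⟫_ℝ *
        ⟪J (f k) (f b), J (f l) (f a)⟫_ℝ := by
    intro k l
    have : ∀ u v w p : V, ⟪J u v, J w p⟫_ℝ = - ⟪J w (J u v), p⟫_ℝ := fun u v w p => by
      rw [hskew w, neg_neg, real_inner_comm]
    simp only [this _ _ _ (f _), neg_mul_neg]
    rw [Finset.sum_congr rfl fun c _ => by rw [real_inner_comm (f c) (J (f k) (J (f l) x))],
      f.sum_inner_mul_inner, real_inner_comm]
    conv_lhs => rw [expand (J (f k) x), expand (J (f l) x)]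
    simp only [map_sum, map_smul, sum_inner, inner_sum, real_inner_smul_left,
      real_inner_smul_right]
    refine Finset.sum_congr rfl fun a _ => Finset.sum_congr rfl fun b _ => ?_
    rw [← this, ← mul_assoc]
  simp only [hl, hr]
  exact sum_swap_pairs _

theorem sum_sq_curv_of_orthogonal {br nab : V → V → V} (hB : ∀ X Y, B X Y = br X Y)
    (hanti : ∀ X Y, B X Y = - B Y X) (h2 : ∀ X Y Z, B (B X Y) Z = 0)
    (hJ : ∀ z x y, ⟪J z x, y⟫_ℝ = ⟪B x y, z⟫_ℝ) (hnab : IsLeviCivita br nab)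
    {ι : Type*} [Fintype ι] (f : OrthonormalBasis ι ℝ V)
    (hf : ∀ a, J (f a) = 0 ∨ ((∀ u, J u (f a) = 0) ∧ B (f a) = 0))
    {x : V} (hx : J x = 0) :
    16 * ∑ a, ∑ b, ∑ c, curv br nab x (f a) (f b) (f c) ^ 2 =
      6 * ∑ a, ∑ b, ∑ c, ⟪B x (f a), B (f b) (f c)⟫_ℝ ^ 2 +
      2 * ∑ a, ∑ b, ∑ c,
        (⟪J (f a) x, J (f b) (f c)⟫_ℝ + ⟪J (f b) x, J (f a) (f c)⟫_ℝ) ^ 2 := by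
  have hskew : ∀ z x y, ⟪J z x, y⟫_ℝ = - ⟪J z y, x⟫_ℝ := fun z x y => by
    rw [hJ, hJ, hanti, inner_neg_left]
  set ε : ι → ι → ι → ℝ := fun a b c => ⟪B x (f a), B (f b) (f c)⟫_ℝ with hε
  set δ : ι → ι → ι → ℝ := fun a b c => ⟪J (f a) x, J (f b) (f c)⟫_ℝ with hδ
  have εanti : ∀ a b c, ε a b c = - ε a c b := fun a b c => by
    simp only [hε]; rw [hanti (f b), inner_neg_right]
  have pt : ∀ a b c, 16 * curv br nab x (f a) (f b) (f c) ^ 2 =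
      (ε c a b ^ 2 + ε b a c ^ 2 + 4 * ε a b c ^ 2) + (-2) * (ε c b a * ε b c a) +
        4 * (ε a c b * ε c a b) + 4 * (ε a b c * ε b a c)
        + δ c a b ^ 2 + δ b a c ^ 2 +
        (2 * δ b c a ^ 2 + 2 * δ c b a ^ 2 - (δ b c a + δ c b a) ^ 2) := fun a b c => by
    have h4 : 4 * curv br nab x (f a) (f b) (f c) =
        (- ε c a b + ε b a c + 2 * ε a b c) - δ c a b - δ c b a + δ b a c + δ b c a := by
      rw [four_mul_curv hB hanti h2 hJ hnab]
      simp only [hε, hδ, hx, LinearMap.zero_apply, zero_add, inner_add_right,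
        real_inner_comm (B x (f b)), real_inner_comm (J (f b) x)]
      ring
    rw [show (16 : ℝ) * curv br nab x (f a) (f b) (f c) ^ 2 =
      (4 * curv br nab x (f a) (f b) (f c)) ^ 2 by ring, h4]
    have e1 : (- ε c a b + ε b a c + 2 * ε a b c) * (- δ c a b - δ c b a + δ b a c + δ b c a)
        = 0 := by
      have hBf : ∀ a p, B (f a) = 0 → B p (f a) = 0 := fun a p h => by rw [hanti, h]; simp
      rcases hf a with h | ⟨-, h⟩
      · rcases hf b with h' | ⟨-, h'⟩
        · rcases hf c with h'' | ⟨-, h''⟩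
          · simp [hδ, h, h', h'']
          · simp [hε, hBf c _ h'']
        · simp [hε, h', hBf b _ h']
      · simp [hε, h, hBf a _ h]
    have z1 : δ c a b * δ c b a = 0 := by
      rcases hf a with h | ⟨h, -⟩ <;> simp [hδ, h]
    have z2 : δ c a b * δ b a c = 0 := by
      rcases hf b with h | ⟨h, -⟩ <;> simp [hδ, h]
    have z3 : δ c a b * δ b c a = 0 := by
      rcases hf a with h | ⟨h, -⟩ <;> simp [hδ, h]
    have z4 : δ c b a * δ b a c = 0 := by
      rcases hf a with h | ⟨h, -⟩ <;> simp [hδ, h]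
    have z5 : δ b a c * δ b c a = 0 := by
      rcases hf a with h | ⟨h, -⟩ <;> simp [hδ, h]
    rw [εanti c b a, εanti b c a, εanti a c b]
    linear_combination 2 * e1 + 2 * z1 - 2 * z2 - 2 * z3 - 2 * z4 + 2 * z5
  have hK : ∑ a, ∑ b, ∑ c, ε a b c * ε b a c = ∑ a, ∑ b, ∑ c, δ a b c * δ b a c :=
    sum_inner_bracket_mul_eq hJ hskew f x
  have hT : ∑ a, ∑ b, ∑ c, (δ a b c + δ b a c) ^ 2 =
      2 * ∑ a, ∑ b, ∑ c, δ a b c ^ 2 + 2 * ∑ a, ∑ b, ∑ c, δ a b c * δ b a c := by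
    have : ∀ a b c, (δ a b c + δ b a c) ^ 2 =
      δ a b c ^ 2 + δ b a c ^ 2 + 2 * (δ a b c * δ b a c) := fun a b c => by ring
    simp only [this, Finset.sum_add_distrib]
    rw [sum_swap_left fun a b c => δ a b c ^ 2]
    simp only [← Finset.mul_sum]
    ring
  change _ = 6 * ∑ a, ∑ b, ∑ c, ε a b c ^ 2 + 2 * ∑ a, ∑ b, ∑ c, (δ a b c + δ b a c) ^ 2
  simp only [Finset.mul_sum, pt, Finset.sum_add_distrib, Finset.sum_sub_distrib]
  simp only [← Finset.mul_sum]
  rw [sum_rotate fun a b c => ε a b c ^ 2, sum_swap_left fun a b c => ε a b c ^ 2,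
    sum_reverse fun a b c => ε a b c * ε b a c, sum_swap_right fun a b c => ε a b c * ε b a c,
    sum_rotate fun a b c => δ a b c ^ 2, sum_swap_left fun a b c => δ a b c ^ 2,
    sum_rotate' fun a b c => δ a b c ^ 2, sum_reverse fun a b c => δ a b c ^ 2,
    sum_rotate' fun a b c => (δ a b c + δ b a c) ^ 2, hK]
  linarith

theorem bracket_eq_zero_of_anticommute {ι : Type*} [Fintype ι] (f : OrthonormalBasis ι ℝ V)
    (hJ : ∀ z x y, ⟪J z x, y⟫_ℝ = ⟪B x y, z⟫_ℝ)
    (h : ∀ x y a b, ⟪J (f a) (f b), J (B (f x) (f y)) (f b)⟫_ℝ = 0) : B = 0 := by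
  have hzero : ∀ x y b, J (B (f x) (f y)) (f b) = 0 := fun x y b => by
    have hs : J (B (f x) (f y)) (f b) = ∑ a, ⟪f a, B (f x) (f y)⟫_ℝ • J (f a) (f b) := by
      conv_lhs => rw [← f.sum_repr' (B (f x) (f y))]
      simp
    have hi : ⟪J (B (f x) (f y)) (f b), J (B (f x) (f y)) (f b)⟫_ℝ =
        ⟪∑ a, ⟪f a, B (f x) (f y)⟫_ℝ • J (f a) (f b), J (B (f x) (f y)) (f b)⟫_ℝ := by
      rw [← hs]
    rw [← inner_self_eq_zero (𝕜 := ℝ), hi]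
    simp [sum_inner, real_inner_smul_left, h]
  refine f.toBasis.ext fun x => f.toBasis.ext fun y => ?_
  simp only [OrthonormalBasis.coe_toBasis, LinearMap.zero_apply]
  rw [← inner_self_eq_zero (𝕜 := ℝ), ← hJ, hzero, inner_zero_left]

end TwoStep

/-- **Theorem 2 of the paper.** A non-abelian, 2-step nilpotent
metric Lie algebra is not weakly Einstein. -/
theorem twoStepNilpotent_not_weaklyEinstein
    {V : Type*} [NormedAddCommGroup V] [InnerProductSpace ℝ V] [FiniteDimensional ℝ V]
    (br : V → V → V) (hbr : IsLieBracket br)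
    (hnonab : ∃ X Y : V, br X Y ≠ 0)
    (h2step : ∀ X Y Z : V, br (br X Y) Z = 0)
    (nab : V → V → V) (hnab : IsLeviCivita br nab)
    {ι : Type*} [Fintype ι] (e : OrthonormalBasis ι ℝ V) :
    ¬ WeaklyEinstein br nab e := by
  intro hWE
  obtain ⟨B, hB⟩ := hbr.exists_linearMap
  obtain ⟨J, hJ⟩ := exists_bracket_adjoint e B
  have hanti : ∀ X Y, B X Y = - B Y X := fun X Y => by rw [hB, hB, hbr.antisymm]
  have h2 : ∀ X Y Z, B (B X Y) Z = 0 := fun X Y Z => by rw [hB, hB, h2step]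
  have h2' : ∀ X Y Z, B X (B Y Z) = 0 := fun X Y Z => by rw [hanti, h2, neg_zero]
  have hskew : ∀ z x y, ⟪J z x, y⟫_ℝ = - ⟪J z y, x⟫_ℝ := fun z x y => by
    rw [hJ, hJ, hanti, inner_neg_left]
  have hJB : ∀ u p q, J u (B p q) = 0 := fun u p q =>
    ext_inner_right ℝ fun v => by rw [hJ, h2, inner_zero_left, inner_zero_left]
  have hJJ : ∀ p q, J (J p q) = 0 := fun p q => by
    ext v
    refine ext_inner_right ℝ fun w => ?_
    rw [hJ, real_inner_comm, hJ, h2', LinearMap.zero_apply, inner_zero_left, inner_zero_left]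
  let Z : Submodule ℝ V := LinearMap.ker B
  obtain ⟨n, f, hfZ⟩ := exists_orthonormalBasis_mem_or_mem_orthogonal Z
  have hf : ∀ a, J (f a) = 0 ∨ ((∀ u, J u (f a) = 0) ∧ B (f a) = 0) := fun a => by
    rcases hfZ a with h | h
    · have hBa : B (f a) = 0 := h
      exact Or.inr ⟨fun u => ext_inner_right ℝ fun v => by
        rw [hJ, hBa, LinearMap.zero_apply, inner_zero_left, inner_zero_left], hBa⟩
    · left
      ext v
      refine ext_inner_right ℝ fun w => ?_
      rw [hJ, LinearMap.zero_apply, inner_zero_left]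
      exact (Submodule.mem_orthogonal _ _).1 h _ (LinearMap.ext fun u => h2 v w u)
  obtain ⟨Λ, hΛ⟩ : ∃ Λ : ℝ, ∀ X : V,
      16 * ∑ a, ∑ b, ∑ c, curv br nab X (f a) (f b) (f c) ^ 2 = Λ * ⟪X, X⟫_ℝ := by
    refine ⟨16 * ((∑ i, checkR br nab e (e i) (e i)) / (Fintype.card ι : ℝ)), fun X => ?_⟩
    rw [mul_assoc, ← hWE X X, ← sum_sq_curv_eq hB hanti h2 hJ hnab e f X]
    simp only [checkR, sq]
  have hcentral := fun x y => (sum_sq_curv_of_central hB hanti h2 hJ hnab hf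
    (LinearMap.ext fun u => h2 (f x) (f y) u) (fun u => hJB u _ _)).symm.trans (hΛ _)
  have horth := fun a b => (sum_sq_curv_of_orthogonal hB hanti h2 hJ hnab f hf
    (hJJ (f a) (f b))).symm.trans (hΛ _)
  have hs := Finset.sum_congr (rfl : (Finset.univ : Finset (Fin n)) = _) fun x _ =>
    Finset.sum_congr (rfl : (Finset.univ : Finset (Fin n)) = _) fun y _ => hcentral x y
  have ho := Finset.sum_congr (rfl : (Finset.univ : Finset (Fin n)) = _) fun a _ =>
    Finset.sum_congr (rfl : (Finset.univ : Finset (Fin n)) = _) fun b _ => horth a b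
  simp only [Finset.sum_sub_distrib, Finset.sum_add_distrib, ← Finset.mul_sum] at hs ho
  have hnorm : ∑ x, ∑ y, ⟪B (f x) (f y), B (f x) (f y)⟫_ℝ =
      ∑ a, ∑ b, ⟪J (f a) (f b), J (f a) (f b)⟫_ℝ := by
    simp only [← f.sum_sq_inner, hJ]
    rw [sum_rotate fun a x y => ⟪B (f x) (f y), f a⟫_ℝ ^ 2]
  have hlead : ∑ x, ∑ y, ∑ a, ∑ b, ∑ c,
        ⟪J (f a) (f b), J (B (f x) (f y)) (f c)⟫_ℝ ^ 2 =
      ∑ a, ∑ b, ∑ c, ∑ x, ∑ y, ⟪B (J (f a) (f b)) (f c), B (f x) (f y)⟫_ℝ ^ 2 := by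
    have : ∀ x y a b c, ⟪J (f a) (f b), J (B (f x) (f y)) (f c)⟫_ℝ ^ 2 =
        ⟪B (J (f a) (f b)) (f c), B (f x) (f y)⟫_ℝ ^ 2 := fun x y a b c => by
      rw [real_inner_comm, hskew, hJ, neg_sq]
    simp only [this]
    rw [sum_swap_pairs]
    exact Finset.sum_congr rfl fun a _ => Finset.sum_congr rfl fun b _ =>
      sum_rotate fun c x y => ⟪B (J (f a) (f b)) (f c), B (f x) (f y)⟫_ℝ ^ 2
  rw [hnorm, hlead] at hs
  have hN := sum_sq_nonneg fun i j a b c => ⟪J (f a) (J (f i) (f j)), J (f b) (f c)⟫_ℝ +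
    ⟪J (f b) (J (f i) (f j)), J (f a) (f c)⟫_ℝ
  have hM : ∀ {S M N L : ℝ}, 6 * S - M = L → 6 * S + 2 * N = L → 0 ≤ N → M ≤ 0 := by
    intros
    linarith
  have hzero := eq_zero_of_sum_sq_nonpos (hM hs ho hN)
  have hB0 : B = 0 := bracket_eq_zero_of_anticommute f hJ fun x y a b => by
    linarith [hzero x y a b b]
  obtain ⟨X, Y, hXY⟩ := hnonab
  exact hXY (by rw [← hB, hB0, LinearMap.zero_apply, LinearMap.zero_apply])
end
end

section
/- Let m, d ≥ 1 and let J_1,…,J_m be skew-symmetric endomorphisms of the d-dimensional Euclidean space, not all zero, satisfying Tr(J_a J_b) = 0 for all a ≠ b. Set S_{ab} = −(1/2)(J_a J_b + J_b J_a). Then there is no real number C such that both: (i) Tr(S_{aa}² + 3·Σ_{c≠a} S_{aa}S_{cc} − 2·Σ_{c≠a} S_{ac}²) = 8C for every a = 1,…,m, and (ii) 4·Σ_{a,b} S_{ab}² + 3·Σ_a Tr(S_{aa})·S_{aa} = 8C·id. -/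
open Module
open scoped InnerProductSpace BigOperators

noncomputable section

/-- The trace of the square of a symmetric operator is the square of its Hilbert-Schmidt norm. -/
lemma LinearMap.IsSymmetric.trace_comp_self {E ι : Type*} [NormedAddCommGroup E]
    [InnerProductSpace ℝ E] [Fintype ι] (b : OrthonormalBasis ι ℝ E) {A : E →ₗ[ℝ] E}
    (hA : A.IsSymmetric) : LinearMap.trace ℝ E (A ∘ₗ A) = ∑ i, ‖A (b i)‖ ^ 2 := by
  rw [LinearMap.trace_eq_sum_inner _ b]
  refine Finset.sum_congr rfl fun i _ => ?_
  rw [LinearMap.comp_apply, ← hA, real_inner_self_eq_norm_sq]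

lemma LinearMap.IsSymmetric.trace_comp_self_nonneg {E ι : Type*} [NormedAddCommGroup E]
    [InnerProductSpace ℝ E] [Fintype ι] (b : OrthonormalBasis ι ℝ E) {A : E →ₗ[ℝ] E}
    (hA : A.IsSymmetric) : 0 ≤ LinearMap.trace ℝ E (A ∘ₗ A) := by
  rw [hA.trace_comp_self b]
  positivity

lemma LinearMap.IsSymmetric.eq_zero_of_trace_comp_self {E ι : Type*} [NormedAddCommGroup E]
    [InnerProductSpace ℝ E] [Fintype ι] (b : OrthonormalBasis ι ℝ E) {A : E →ₗ[ℝ] E}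
    (hA : A.IsSymmetric) (h : LinearMap.trace ℝ E (A ∘ₗ A) = 0) : A = 0 := by
  rw [hA.trace_comp_self b, Finset.sum_eq_zero_iff_of_nonneg fun i _ => by positivity] at h
  refine b.toBasis.ext fun i => ?_
  simpa using h i (Finset.mem_univ i)

/-- For a skew-symmetric operator `J`, the trace of `-J²` is the square of its Hilbert-Schmidt
norm. -/
lemma trace_neg_comp_self_of_skew {E ι : Type*} [NormedAddCommGroup E]
    [InnerProductSpace ℝ E] [Fintype ι] (b : OrthonormalBasis ι ℝ E) {J : E →ₗ[ℝ] E}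
    (hJ : ∀ x y : E, ⟪J x, y⟫_ℝ = - ⟪x, J y⟫_ℝ) :
    LinearMap.trace ℝ E (-(J ∘ₗ J)) = ∑ i, ‖J (b i)‖ ^ 2 := by
  rw [LinearMap.trace_eq_sum_inner _ b]
  refine Finset.sum_congr rfl fun i _ => ?_
  rw [LinearMap.neg_apply, LinearMap.comp_apply, inner_neg_right, ← hJ, real_inner_self_eq_norm_sq]

/-- The trace of the product of the positive semidefinite operators `A²` and `-J²` is
nonnegative. -/
lemma trace_sq_comp_neg_sq_nonneg {E ι : Type*} [NormedAddCommGroup E]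
    [InnerProductSpace ℝ E] [Fintype ι] (b : OrthonormalBasis ι ℝ E) {A J : E →ₗ[ℝ] E}
    (hA : A.IsSymmetric) (hJ : ∀ x y : E, ⟪J x, y⟫_ℝ = - ⟪x, J y⟫_ℝ) :
    0 ≤ LinearMap.trace ℝ E ((A ∘ₗ A) ∘ₗ (-(J ∘ₗ J))) := by
  have hcycle : LinearMap.trace ℝ E ((A ∘ₗ A) ∘ₗ (-(J ∘ₗ J))) =
      LinearMap.trace ℝ E (-(J ∘ₗ (A ∘ₗ A) ∘ₗ J)) := by
    rw [LinearMap.comp_neg, map_neg, map_neg, ← LinearMap.comp_assoc, ← Module.End.mul_eq_comp,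
      LinearMap.trace_mul_comm, Module.End.mul_eq_comp]
  rw [hcycle, LinearMap.trace_eq_sum_inner _ b]
  refine Finset.sum_nonneg fun i _ => ?_
  rw [LinearMap.neg_apply, LinearMap.comp_apply, inner_neg_right, ← hJ, LinearMap.comp_apply,
    LinearMap.comp_apply, ← hA]
  exact real_inner_self_nonneg

/-- For skew-symmetric endomorphisms `J_1, …, J_m` of `ℝ^d`,
not all zero, with `Tr(J_a J_b) = 0` for `a ≠ b`, setting
`S_{ab} = −(1/2)(J_a J_b + J_b J_a)`, there is no real `C` satisfying both
diagonal weakly Einstein equations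
`Tr(S_{aa}² + 3 Σ_{c≠a} S_{aa}S_{cc} − 2 Σ_{c≠a} S_{ac}²) = 8C` for all `a`, and
`4 Σ_{a,b} S_{ab}² + 3 Σ_a Tr(S_{aa}) S_{aa} = 8C·id`. -/
theorem twoStep_weaklyEinstein_equations_insoluble
    (m d : ℕ) (hm : 1 ≤ m) (hd : 1 ≤ d)
    (J : Fin m → (EuclideanSpace ℝ (Fin d) →ₗ[ℝ] EuclideanSpace ℝ (Fin d)))
    (hskew : ∀ (a : Fin m) (x y : EuclideanSpace ℝ (Fin d)),
      ⟪J a x, y⟫_ℝ = - ⟪x, J a y⟫_ℝ)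
    (hnz : ∃ a, J a ≠ 0)
    (htr : ∀ a b : Fin m, a ≠ b →
      LinearMap.trace ℝ (EuclideanSpace ℝ (Fin d)) (J a ∘ₗ J b) = 0)
    (S : Fin m → Fin m → (EuclideanSpace ℝ (Fin d) →ₗ[ℝ] EuclideanSpace ℝ (Fin d)))
    (hS : ∀ a b, S a b = (-(1 / 2) : ℝ) • (J a ∘ₗ J b + J b ∘ₗ J a)) :
    ¬ ∃ C : ℝ,
      (∀ a : Fin m,
        LinearMap.trace ℝ (EuclideanSpace ℝ (Fin d))
          (S a a ∘ₗ S a a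
            + (3 : ℝ) • (∑ c ∈ Finset.univ.erase a, S a a ∘ₗ S c c)
            - (2 : ℝ) • (∑ c ∈ Finset.univ.erase a, S a c ∘ₗ S a c)) = 8 * C) ∧
      ((4 : ℝ) • (∑ a : Fin m, ∑ b : Fin m, S a b ∘ₗ S a b)
          + (3 : ℝ) • (∑ a : Fin m,
              (LinearMap.trace ℝ (EuclideanSpace ℝ (Fin d)) (S a a)) • S a a)
        = (8 * C) • LinearMap.id) := by
  rintro ⟨C, h1, h2⟩
  set tr := LinearMap.trace ℝ (EuclideanSpace ℝ (Fin d))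
  let e := EuclideanSpace.basisFun (Fin d) ℝ
  have hsymm : ∀ a b, (S a b).IsSymmetric := by
    intro a b x y
    simp only [hS, LinearMap.smul_apply, LinearMap.add_apply, LinearMap.comp_apply,
      inner_smul_left, inner_smul_right, inner_add_left, inner_add_right, hskew, neg_neg,
      conj_trivial]
    ring
  have hdiag : ∀ a, S a a = -(J a ∘ₗ J a) := by
    intro a
    rw [hS]
    module
  have htr_diag : ∀ a, tr (S a a) = ∑ i, ‖J a (e i)‖ ^ 2 := fun a => by
    rw [hdiag, trace_neg_comp_self_of_skew e (hskew a)]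
  have htr_nonneg : ∀ a, 0 ≤ tr (S a a) := fun a => by
    rw [htr_diag]
    positivity
  have hsq_nonneg : ∀ a b, 0 ≤ tr (S a b ∘ₗ S a b) := fun a b =>
    (hsymm a b).trace_comp_self_nonneg e
  have hprod_nonneg : ∀ a b c, 0 ≤ tr ((S a b ∘ₗ S a b) ∘ₗ S c c) := fun a b c => by
    rw [hdiag c]
    exact trace_sq_comp_neg_sq_nonneg e (hsymm a b) (hskew c)
  have hvert : ∀ a, 3 * ∑ c, tr (S a a ∘ₗ S c c) - 2 * ∑ c, tr (S a c ∘ₗ S a c) = 8 * C := by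
    intro a
    have h := h1 a
    simp only [map_add, map_sub, map_smul, map_sum, smul_eq_mul] at h
    rw [← Finset.add_sum_erase _ (fun c => tr (S a a ∘ₗ S c c)) (Finset.mem_univ a),
      ← Finset.add_sum_erase _ (fun c => tr (S a c ∘ₗ S a c)) (Finset.mem_univ a)]
    linarith
  have hhor : ∀ c, 4 * ∑ a, ∑ b, tr ((S a b ∘ₗ S a b) ∘ₗ S c c)
      + 3 * ∑ a, tr (S a a) * tr (S a a ∘ₗ S c c) = 8 * C * tr (S c c) := by
    intro c
    have h := congrArg (fun f => tr (f ∘ₗ S c c)) h2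
    simpa only [← Module.End.mul_eq_comp, ← Module.End.one_eq_id, add_mul, smul_mul_assoc,
      Finset.sum_mul, one_mul,
      map_add, map_smul, map_sum, smul_eq_mul] using h
  have hsum_vert : ∑ a, tr (S a a) *
      (3 * ∑ c, tr (S a a ∘ₗ S c c) - 2 * ∑ c, tr (S a c ∘ₗ S a c))
      = ∑ c, 8 * C * tr (S c c) :=
    Finset.sum_congr rfl fun a _ => by rw [hvert a]; ring
  have hsum_hor := Finset.sum_congr (rfl : (Finset.univ : Finset (Fin m)) = _) fun c _ => hhor c
  have hbalance : 4 * ∑ c, ∑ a, ∑ b, tr ((S a b ∘ₗ S a b) ∘ₗ S c c)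
      + 2 * ∑ a, tr (S a a) * ∑ c, tr (S a c ∘ₗ S a c) = 0 := by
    rw [← hsum_vert, Finset.sum_add_distrib, ← Finset.mul_sum, ← Finset.mul_sum,
      Finset.sum_comm (f := fun c a => tr (S a a) * tr (S a a ∘ₗ S c c))] at hsum_hor
    simp only [mul_sub, mul_left_comm _ (3 : ℝ), mul_left_comm _ (2 : ℝ),
      Finset.sum_sub_distrib, ← Finset.mul_sum] at hsum_hor ⊢
    linarith
  have hcubic : 0 ≤ ∑ c, ∑ a, ∑ b, tr ((S a b ∘ₗ S a b) ∘ₗ S c c) :=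
    Finset.sum_nonneg fun c _ => Finset.sum_nonneg fun a _ => Finset.sum_nonneg fun b _ =>
      hprod_nonneg a b c
  have hrow_nonneg : ∀ a, 0 ≤ ∑ c, tr (S a c ∘ₗ S a c) := fun a =>
    Finset.sum_nonneg fun c _ => hsq_nonneg a c
  obtain ⟨a, ha⟩ := hnz
  have hterm : tr (S a a) * tr (S a a ∘ₗ S a a) ≤ 0 := by
    calc tr (S a a) * tr (S a a ∘ₗ S a a)
        ≤ tr (S a a) * ∑ c, tr (S a c ∘ₗ S a c) :=
          mul_le_mul_of_nonneg_left (Finset.single_le_sum (f := fun c => tr (S a c ∘ₗ S a c))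
            (fun c _ => hsq_nonneg a c) (Finset.mem_univ a)) (htr_nonneg a)
      _ ≤ ∑ a, tr (S a a) * ∑ c, tr (S a c ∘ₗ S a c) :=
          Finset.single_le_sum (f := fun a => tr (S a a) * ∑ c, tr (S a c ∘ₗ S a c))
            (fun a _ => mul_nonneg (htr_nonneg a) (hrow_nonneg a)) (Finset.mem_univ a)
      _ ≤ 0 := by linarith
  have hzero : tr (S a a) = 0 := by
    rcases mul_eq_zero.mp (hterm.antisymm (mul_nonneg (htr_nonneg a) (hsq_nonneg a a))) with h | h
    · exact h
    · rw [(hsymm a a).eq_zero_of_trace_comp_self e h, map_zero]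
  rw [htr_diag, Finset.sum_eq_zero_iff_of_nonneg fun i _ => by positivity] at hzero
  exact ha (e.toBasis.ext fun i => by simpa using hzero i (Finset.mem_univ i))
end
end

section
/- For all real numbers a, b, c, d, f, g, h with h ≠ 0, the metric Lie algebra on ℝ⁵ with orthonormal basis E_1,…,E_5 whose nonzero Lie brackets are [E_1,E_2] = aE_3 + bE_4 + cE_5, [E_1,E_3] = dE_4 + fE_5, [E_1,E_4] = gE_5, [E_2,E_3] = hE_5 (these brackets satisfy the Jacobi identity for all parameter values) is not weakly Einstein. -/
open Module
open scoped InnerProductSpace BigOperators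

noncomputable section

variable {V : Type*} [NormedAddCommGroup V] [InnerProductSpace ℝ V]

/-- The skew-symmetric `5 × 5` matrix with upper triangular entries `p`, read row by row. -/
def skewOfUpper (p : Fin 10 → ℝ) : Matrix (Fin 5) (Fin 5) ℝ :=
  !![0, p 0, p 1, p 2, p 3;
    -p 0, 0, p 4, p 5, p 6;
    -p 1, -p 4, 0, p 7, p 8;
    -p 2, -p 5, -p 7, 0, p 9;
    -p 3, -p 6, -p 8, -p 9, 0]

lemma sum_skewOfUpper_mul (p q : Fin 10 → ℝ) :
    ∑ i, ∑ j, skewOfUpper p i j * skewOfUpper q i j = 2 * (p ⬝ᵥ q) := by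
  simp [skewOfUpper, Fin.sum_univ_succ, dotProduct]
  ring

section Curvature

variable (a b c d f g h : ℝ)

/-- The bracket with `[E_1,E_2] = aE_3 + bE_4 + cE_5`, `[E_1,E_3] = dE_4 + fE_5`,
`[E_1,E_4] = gE_5` and `[E_2,E_3] = hE_5`. -/
def IsFamilyBracket
    (br : EuclideanSpace ℝ (Fin 5) → EuclideanSpace ℝ (Fin 5) → EuclideanSpace ℝ (Fin 5)) :
    Prop :=
  ∀ x y : EuclideanSpace ℝ (Fin 5),
    br x y = ![0, 0,
      a * (x 0 * y 1 - x 1 * y 0),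
      b * (x 0 * y 1 - x 1 * y 0) + d * (x 0 * y 2 - x 2 * y 0),
      c * (x 0 * y 1 - x 1 * y 0) + f * (x 0 * y 2 - x 2 * y 0)
        + g * (x 0 * y 3 - x 3 * y 0) + h * (x 1 * y 2 - x 2 * y 1)]

/-- The upper triangular entries of `4 R(E_i, E_j, ·, ·)` for `i < j`, and zero otherwise. -/
def upperCurvEntries : Fin 5 → Fin 5 → Fin 10 → ℝ
  | 0, 1 => ![3 * a ^ 2 + 3 * b ^ 2 + 3 * c ^ 2, 3 * b * d + 3 * c * f, a * d + 3 * c * g,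
      a * f + b * g, 3 * c * h, 0, a * h, -g * h, 0, d * h]
  | 0, 2 => ![3 * b * d + 3 * c * f, -a ^ 2 + 3 * d ^ 2 + 3 * f ^ 2, -a * b + 3 * f * g,
      -a * c + d * g, 3 * f * h, g * h, 0, 0, -a * h, -b * h]
  | 0, 3 => ![a * d + 3 * c * g, -a * b + 3 * f * g, -b ^ 2 - d ^ 2 + 3 * g ^ 2,
      -b * c - d * f, 2 * g * h, 0, 0, 0, 0, 0]
  | 0, 4 => ![a * f + b * g, -a * c + d * g, -b * c - d * f, -c ^ 2 - f ^ 2 - g ^ 2, 0,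
      -d * h, -f * h, b * h, c * h, 0]
  | 1, 2 => ![3 * c * h, 3 * f * h, 2 * g * h, 0, -a ^ 2 + 3 * h ^ 2, -a * b, -a * c,
      a * d, a * f, b * f - c * d]
  | 1, 3 => ![0, g * h, 0, -d * h, -a * b, -b ^ 2, -b * c, -b * d, a * g - c * d, b * g]
  | 1, 4 => ![a * h, 0, 0, -f * h, -a * c, -b * c, -c ^ 2 - h ^ 2, a * g - b * f, -c * f,
      -c * g]
  | 2, 3 => ![-g * h, 0, 0, b * h, a * d, -b * d, a * g - b * f, -d ^ 2, -d * f, d * g]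
  | 2, 4 => ![0, -a * h, 0, c * h, a * f, a * g - c * d, -c * f, -d * f, -f ^ 2 - h ^ 2,
      -f * g]
  | 3, 4 => ![d * h, -b * h, 0, 0, b * f - c * d, b * g, -c * g, d * g, -f * g, -g ^ 2]
  | _, _ => 0

/-- The upper triangular entries of `4 R(E_i, E_j, ·, ·)`. -/
def curvEntries (i j : Fin 5) : Fin 10 → ℝ :=
  upperCurvEntries a b c d f g h i j - upperCurvEntries a b c d f g h j i

variable {a b c d f g h}
variable {br nab : EuclideanSpace ℝ (Fin 5) → EuclideanSpace ℝ (Fin 5) → EuclideanSpace ℝ (Fin 5)}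

lemma leviCivita_coords
    (hbr : IsFamilyBracket a b c d f g h br) (hnab : IsLeviCivita br nab)
    (x y : EuclideanSpace ℝ (Fin 5)) :
    nab x y = !₂[
      (1 / 2) * (a * (x 1 * y 2 + x 2 * y 1) + b * (x 1 * y 3 + x 3 * y 1)
        + c * (x 1 * y 4 + x 4 * y 1) + d * (x 2 * y 3 + x 3 * y 2)
        + f * (x 2 * y 4 + x 4 * y 2) + g * (x 3 * y 4 + x 4 * y 3)),
      (1 / 2) * (-a * (x 0 * y 2 + x 2 * y 0) - b * (x 0 * y 3 + x 3 * y 0)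
        - c * (x 0 * y 4 + x 4 * y 0) + h * (x 2 * y 4 + x 4 * y 2)),
      (1 / 2) * (a * (x 0 * y 1 - x 1 * y 0) - d * (x 0 * y 3 + x 3 * y 0)
        - f * (x 0 * y 4 + x 4 * y 0) - h * (x 1 * y 4 + x 4 * y 1)),
      (1 / 2) * (b * (x 0 * y 1 - x 1 * y 0) + d * (x 0 * y 2 - x 2 * y 0)
        - g * (x 0 * y 4 + x 4 * y 0)),
      (1 / 2) * (c * (x 0 * y 1 - x 1 * y 0) + f * (x 0 * y 2 - x 2 * y 0)
        + g * (x 0 * y 3 - x 3 * y 0) + h * (x 1 * y 2 - x 2 * y 1))] := by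
  unfold IsFamilyBracket at hbr
  have key (k : Fin 5) := hnab x y (EuclideanSpace.single k 1)
  simp only [EuclideanSpace.inner_single_right] at key
  ext k
  have hk := key k
  fin_cases k <;>
  · simp [PiLp.inner_apply, hbr, Fin.sum_univ_succ] at hk ⊢
    linarith

set_option maxHeartbeats 4000000 in
lemma curvOp_basisFun
    (hbr : IsFamilyBracket a b c d f g h br) (hnab : IsLeviCivita br nab) (i j : Fin 5)
    (z : EuclideanSpace ℝ (Fin 5)) :
    curvOp br nab (EuclideanSpace.basisFun (Fin 5) ℝ i) (EuclideanSpace.basisFun (Fin 5) ℝ j) z =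
      WithLp.toLp 2 (fun l ↦
        (1 / 4) * ∑ k, z k * skewOfUpper (curvEntries a b c d f g h i j) k l) := by
  have hnabla := leviCivita_coords hbr hnab
  unfold IsFamilyBracket at hbr
  ext l
  fin_cases i <;> fin_cases j <;> fin_cases l <;>
    simp [curvOp, hnabla, hbr, curvEntries, upperCurvEntries, skewOfUpper,
      Fin.sum_univ_succ] <;> ring

lemma curv_basisFun
    (hbr : IsFamilyBracket a b c d f g h br) (hnab : IsLeviCivita br nab) (i j k l : Fin 5) :
    curv br nab (EuclideanSpace.basisFun (Fin 5) ℝ i) (EuclideanSpace.basisFun (Fin 5) ℝ j)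
        (EuclideanSpace.basisFun (Fin 5) ℝ k) (EuclideanSpace.basisFun (Fin 5) ℝ l) =
      (1 / 4) * skewOfUpper (curvEntries a b c d f g h i j) k l := by
  rw [curv, curvOp_basisFun hbr hnab, EuclideanSpace.basisFun_apply, EuclideanSpace.basisFun_apply,
    EuclideanSpace.inner_single_right]
  simp

lemma checkR_basisFun
    (hbr : IsFamilyBracket a b c d f g h br) (hnab : IsLeviCivita br nab) (i j : Fin 5) :
    checkR br nab (EuclideanSpace.basisFun (Fin 5) ℝ)
        (EuclideanSpace.basisFun (Fin 5) ℝ i) (EuclideanSpace.basisFun (Fin 5) ℝ j) =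
      (1 / 8) * ∑ k, curvEntries a b c d f g h i k ⬝ᵥ curvEntries a b c d f g h j k := by
  have hmul (x y : ℝ) : 1 / 4 * x * (1 / 4 * y) = 1 / 16 * (x * y) := by ring
  rw [checkR, Finset.mul_sum]
  refine Finset.sum_congr rfl fun k _ ↦ ?_
  have := sum_skewOfUpper_mul (curvEntries a b c d f g h i k) (curvEntries a b c d f g h j k)
  simp only [curv_basisFun hbr hnab, hmul, ← Finset.mul_sum, this]
  ring

end Curvature

section Algebra

variable {a b c d f g h : ℝ}

lemma false_of_curvature_eqs_of_eq_zero (hh : h ≠ 0)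
    (e12 : f * (5 * (c ^ 2 + d ^ 2 + f ^ 2 + g ^ 2 + h ^ 2) - b ^ 2) + 6 * b * c * d = 0)
    (e13 : c * (d ^ 2 - 5 * (b ^ 2 + c ^ 2 + f ^ 2 + g ^ 2 + h ^ 2)) - 6 * b * d * f = 0)
    (e25 : g * (2 * b ^ 3 - b * c ^ 2 + 2 * b * d ^ 2 - c * d * f) = 0)
    (e35 : g * (2 * b ^ 2 * d - b * c * f + 2 * d ^ 3 - d * f ^ 2) = 0)
    (e45 : (b * c + d * f) * (b ^ 2 + c ^ 2 + d ^ 2 + f ^ 2 + h ^ 2) = 0)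
    (d25 : 5 * b ^ 4 + 9 * b ^ 2 * c ^ 2 + 5 * b ^ 2 * d ^ 2 - b ^ 2 * h ^ 2 + 8 * b * c * d * f
      + 4 * c ^ 4 + 3 * c ^ 2 * f ^ 2 + 3 * c ^ 2 * g ^ 2 + 8 * c ^ 2 * h ^ 2 - d ^ 2 * f ^ 2
      - d ^ 2 * g ^ 2 - f ^ 4 - 2 * f ^ 2 * g ^ 2 + 3 * f ^ 2 * h ^ 2 - g ^ 4 + 3 * g ^ 2 * h ^ 2
      + 4 * h ^ 4 = 0)
    (d35 : 5 * b ^ 2 * d ^ 2 - b ^ 2 * c ^ 2 - b ^ 2 * g ^ 2 + 8 * b * c * d * f - c ^ 4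
      + 3 * c ^ 2 * f ^ 2 - 2 * c ^ 2 * g ^ 2 + 3 * c ^ 2 * h ^ 2 + 5 * d ^ 4 + 9 * d ^ 2 * f ^ 2
      - d ^ 2 * h ^ 2 + 4 * f ^ 4 + 3 * f ^ 2 * g ^ 2 + 8 * f ^ 2 * h ^ 2 - g ^ 4
      + 3 * g ^ 2 * h ^ 2 + 4 * h ^ 4 = 0)
    (d45 : (b ^ 2 + d ^ 2) ^ 2 - 3 * b ^ 2 * g ^ 2 - 3 * d ^ 2 * g ^ 2
      - (c ^ 2 + f ^ 2 + h ^ 2) ^ 2 + 3 * c ^ 2 * g ^ 2 + 3 * f ^ 2 * g ^ 2 + 4 * g ^ 4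
      + 3 * g ^ 2 * h ^ 2 = 0) : False := by
  have hpos : 0 < h ^ 2 := by positivity
  have hbc : b * c = -(d * f) := by
    have := (mul_eq_zero.1 e45).resolve_right (by positivity)
    linarith
  set T := b ^ 2 + d ^ 2 - 5 * (c ^ 2 + f ^ 2 + g ^ 2 + h ^ 2) with hT
  have hf : f * T = 0 := by linear_combination 6 * d * hbc - e12
  have hc : c * T = 0 := by linear_combination 6 * b * hbc + e13
  by_cases hT0 : T = 0
  · have hbd : 0 < b ^ 2 + d ^ 2 := by
      have : b ^ 2 + d ^ 2 = 5 * (c ^ 2 + f ^ 2 + g ^ 2 + h ^ 2) := by linear_combination hT0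
      rw [this]
      positivity
    have hgb : g * b * (b ^ 2 + d ^ 2) = 0 := by
      linear_combination (1 / 2) * e25 + (1 / 2) * g * c * hbc
    have hgd : g * d * (b ^ 2 + d ^ 2) = 0 := by
      linear_combination (1 / 2) * e35 + (1 / 2) * g * f * hbc
    have hg : g = 0 := by
      have h1 := (mul_eq_zero.1 hgb).resolve_right hbd.ne'
      have h2 := (mul_eq_zero.1 hgd).resolve_right hbd.ne'
      have : g * (b ^ 2 + d ^ 2) = 0 := by linear_combination b * h1 + d * h2
      exact (mul_eq_zero.1 this).resolve_right hbd.ne'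
    subst hg
    have hs : b ^ 2 + d ^ 2 = 5 * (c ^ 2 + f ^ 2 + h ^ 2) := by linear_combination hT0
    have : 24 * (c ^ 2 + f ^ 2 + h ^ 2) ^ 2 = 0 := by
      rw [hs] at d45
      linear_combination d45
    have : 0 < 24 * (c ^ 2 + f ^ 2 + h ^ 2) ^ 2 := by positivity
    linarith
  · obtain rfl := (mul_eq_zero.1 hf).resolve_right hT0
    obtain rfl := (mul_eq_zero.1 hc).resolve_right hT0
    by_cases hg : g = 0
    · subst hg
      have hs : b ^ 2 + d ^ 2 = h ^ 2 := by
        have : (b ^ 2 + d ^ 2 - h ^ 2) * (b ^ 2 + d ^ 2 + h ^ 2) = 0 := by linear_combination d45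
        have := (mul_eq_zero.1 this).resolve_right (by positivity)
        linarith
      have : 4 * b ^ 2 * h ^ 2 + 4 * h ^ 4 = 0 := by linear_combination d25 - 5 * b ^ 2 * hs
      have : 0 < 4 * b ^ 2 * h ^ 2 + 4 * h ^ 4 := by positivity
      linarith
    · have h1 := (mul_eq_zero.1 e25).resolve_left hg
      have h2 := (mul_eq_zero.1 e35).resolve_left hg
      have h3 : (b ^ 2 + d ^ 2) ^ 2 = 0 := by linear_combination (b / 2) * h1 + (d / 2) * h2
      have h4 : b ^ 2 + d ^ 2 = 0 := by simpa using h3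
      have hb : b = 0 := by nlinarith [sq_nonneg b, sq_nonneg d]
      have hd : d = 0 := by nlinarith [sq_nonneg b, sq_nonneg d]
      subst hb hd
      have hs : h ^ 2 = 4 * g ^ 2 := by
        have : (4 * g ^ 2 - h ^ 2) * (g ^ 2 + h ^ 2) = 0 := by linear_combination d45
        have := (mul_eq_zero.1 this).resolve_right (by positivity)
        linarith
      have : 75 * g ^ 4 = 0 := by
        linear_combination d35 - (4 * h ^ 2 + 19 * g ^ 2) * hs
      exact hg (by simpa using this)

lemma false_of_curvature_eqs_of_ne_zero (hh : h ≠ 0) (ha : a ≠ 0)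
    (e12 : f * (5 * (c ^ 2 + d ^ 2 + f ^ 2 + g ^ 2 + h ^ 2) - 3 * a ^ 2 - b ^ 2)
      - 2 * a * b * g + 6 * b * c * d = 0)
    (e13 : c * (d ^ 2 - 2 * a ^ 2 - 5 * (b ^ 2 + c ^ 2 + f ^ 2 + g ^ 2 + h ^ 2))
      - a * d * g - 6 * b * d * f = 0)
    (e14 : 3 * b * c = d * f)
    (e15 : c ^ 2 + d ^ 2 = 2 * (a ^ 2 + b ^ 2))
    (e23 : 2 * a ^ 2 * b * d + 2 * a ^ 2 * c * f - 3 * a * b * c * g + a * d * f * g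
      + b * d * (5 * (b ^ 2 + c ^ 2 + d ^ 2 + f ^ 2) + g ^ 2 - h ^ 2)
      + 5 * c * f * (b ^ 2 + c ^ 2 + d ^ 2 + f ^ 2 + g ^ 2 + h ^ 2) = 0)
    (e24 : a * d * (2 * a ^ 2 - b ^ 2 + 2 * c ^ 2 + 2 * g ^ 2 - h ^ 2) - 3 * a * b * c * f
      + c * g * (5 * a ^ 2 + 2 * b ^ 2 + 5 * c ^ 2 - d ^ 2 + 5 * f ^ 2 + 5 * g ^ 2 + 5 * h ^ 2)
      + 3 * b * d * f * g = 0)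
    (e35 : a * c * (a ^ 2 + b ^ 2 + c ^ 2 - d ^ 2 + g ^ 2) + a * b * d * f + 2 * b ^ 2 * d * g
      - b * c * f * g + 2 * d ^ 3 * g - d * f ^ 2 * g = 0)
    (d35 : a ^ 4 + a ^ 2 * b ^ 2 - 2 * a ^ 2 * d ^ 2 - 3 * a ^ 2 * f ^ 2 - 3 * a ^ 2 * h ^ 2
      - 4 * a * b * f * g + 5 * b ^ 2 * d ^ 2 - b ^ 2 * c ^ 2 - b ^ 2 * g ^ 2
      + 8 * b * c * d * f - c ^ 4
      + 3 * c ^ 2 * f ^ 2 - 2 * c ^ 2 * g ^ 2 + 3 * c ^ 2 * h ^ 2 + 5 * d ^ 4 + 9 * d ^ 2 * f ^ 2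
      - d ^ 2 * h ^ 2 + 4 * f ^ 4 + 3 * f ^ 2 * g ^ 2 + 8 * f ^ 2 * h ^ 2 - g ^ 4
      + 3 * g ^ 2 * h ^ 2 + 4 * h ^ 4 = 0) : False := by
  have ha2 : 0 < a ^ 2 := by positivity
  have hh2 : 0 < h ^ 2 := by positivity
  set P := 7 * a ^ 2 + 9 * b ^ 2 + 2 * d ^ 2 + 5 * (f ^ 2 + g ^ 2 + h ^ 2) with hP
  set Q := 21 * b ^ 2 + 6 * c ^ 2 + 5 * (f ^ 2 + g ^ 2 + h ^ 2) with hQ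
  have hPpos : 0 < P := by positivity
  have hQpos : 0 < Q := by positivity
  have hfP : f * P = 2 * a * b * g := by
    linear_combination e12 - 2 * d * e14 - 5 * f * e15
  have hcQ : c * Q = -(a * d * g) := by
    linear_combination -e13 + 6 * b * e14 + c * e15
  have hbc : b * c = 0 := by
    have : b * c * (3 * P + 2 * Q) = 0 := by
      linear_combination P * e14 + d * hfP + 2 * b * hcQ
    exact (mul_eq_zero.1 this).resolve_right (by positivity)
  rcases eq_or_ne c 0 with rfl | hc
  · have hd2 : d ^ 2 = 2 * (a ^ 2 + b ^ 2) := by linear_combination e15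
    have hd : d ≠ 0 := by
      rintro rfl
      nlinarith [sq_nonneg b]
    have hf : f = 0 := by simpa [hd] using e14.symm
    have hg : g = 0 := by simpa [hd, ha] using hcQ.symm
    subst hf hg
    have hh' : h ^ 2 = 2 * a ^ 2 - b ^ 2 := by
      have : a * d * (2 * a ^ 2 - b ^ 2 - h ^ 2) = 0 := by linear_combination e24
      have := (mul_eq_zero.1 this).resolve_left (mul_ne_zero ha hd)
      linarith
    have hb : b = 0 := by
      have : b * (d * (10 * a ^ 2 + 16 * b ^ 2)) = 0 := by
        linear_combination e23 - 5 * b * d * hd2 + b * d * hh'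
      exact (mul_eq_zero.1 this).resolve_right (mul_ne_zero hd (by positivity))
    subst hb
    have hd2' : d ^ 2 = 2 * a ^ 2 := by linear_combination hd2
    have hh2' : h ^ 2 = 2 * a ^ 2 := by linear_combination hh'
    have e : 23 * a ^ 4 = 0 := by
      rw [show d ^ 4 = (d ^ 2) ^ 2 by ring, show h ^ 4 = (h ^ 2) ^ 2 by ring, hd2', hh2'] at d35
      linear_combination d35
    exact ha (by simpa using e)
  · have hb : b = 0 := (mul_eq_zero.1 hbc).resolve_right hc
    subst hb
    have hf : f = 0 := by
      have : f * P = 0 := by linear_combination hfP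
      exact (mul_eq_zero.1 this).resolve_right hPpos.ne'
    subst hf
    have hc2 : 0 < c ^ 2 := by positivity
    have h1 : 5 * h ^ 4 = 12 * a ^ 2 * c ^ 2 + 12 * c ^ 4 + 16 * c ^ 2 * g ^ 2
        + 4 * c ^ 2 * h ^ 2 + 7 * a ^ 2 * g ^ 2 + 5 * g ^ 4 + 10 * a ^ 2 * h ^ 2 := by
      apply mul_left_cancel₀ hc
      linear_combination g * e24 - (2 * a ^ 2 + 2 * c ^ 2 + 2 * g ^ 2 - h ^ 2) * hcQ
        + c * g ^ 2 * e15
    have h2 : 2 * a ^ 2 ≤ h ^ 2 := by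
      have : 0 ≤ h ^ 2 * (h ^ 2 - 2 * a ^ 2) := by
        have : 0 ≤ 12 * a ^ 2 * c ^ 2 + 12 * c ^ 4 + 16 * c ^ 2 * g ^ 2
          + 4 * c ^ 2 * h ^ 2 + 7 * a ^ 2 * g ^ 2 + 5 * g ^ 4 := by positivity
        linarith
      linarith [nonneg_of_mul_nonneg_right this hh2]
    have h3 : a ^ 2 * (a ^ 2 + c ^ 2 - d ^ 2 + g ^ 2)
        = 2 * d ^ 2 * (6 * c ^ 2 + 5 * (g ^ 2 + h ^ 2)) := by
      apply mul_left_cancel₀ hc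
      linear_combination a * e35 - 2 * d ^ 2 * hcQ
    have h4 : a ^ 2 * d ^ 2 * g ^ 2 = c ^ 2 * (6 * c ^ 2 + 5 * (g ^ 2 + h ^ 2)) ^ 2 := by
      linear_combination -(c * Q - a * d * g) * hcQ
    have hg : g ≠ 0 := by
      rintro rfl
      have : 0 < c ^ 2 * (6 * c ^ 2 + 5 * (0 ^ 2 + h ^ 2)) ^ 2 := by positivity
      linarith
    have hg2 : 0 < g ^ 2 := by positivity
    have h5 : c ^ 2 ≤ d ^ 2 := by
      have e1 : 2 * a ^ 2 * g ^ 2 ≤ h ^ 2 * g ^ 2 := by gcongr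
      have e2 : 200 * (a ^ 2 * g ^ 2) ≤ (6 * c ^ 2 + 5 * (g ^ 2 + h ^ 2)) ^ 2 := by
        have : (5 * (g ^ 2 + h ^ 2)) ^ 2 ≤ (6 * c ^ 2 + 5 * (g ^ 2 + h ^ 2)) ^ 2 := by
          gcongr
          linarith
        linarith [sq_nonneg (g ^ 2 - h ^ 2)]
      have e3 := mul_le_mul_of_nonneg_left e2 hc2.le
      have e4 : a ^ 2 * g ^ 2 * (200 * c ^ 2) ≤ a ^ 2 * g ^ 2 * d ^ 2 := by linarith
      linarith [le_of_mul_le_mul_left e4 (by positivity)]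
    have h6 : 3 * c ^ 4 + 2 * c ^ 2 * g ^ 2
        = d ^ 4 + 46 * c ^ 2 * d ^ 2 + 38 * d ^ 2 * g ^ 2 + 40 * d ^ 2 * h ^ 2 := by
      linear_combination 4 * h3 + (3 * c ^ 2 - d ^ 2 + 2 * a ^ 2 + 2 * g ^ 2) * e15
    have h7 : c ^ 2 * c ^ 2 ≤ d ^ 2 * c ^ 2 := by gcongr
    have h8 : c ^ 2 * g ^ 2 ≤ d ^ 2 * g ^ 2 := by gcongr
    have h9 : 0 < c ^ 2 * c ^ 2 := by positivity
    have h10 : 0 ≤ d ^ 4 + 36 * d ^ 2 * g ^ 2 + 40 * d ^ 2 * h ^ 2 := by positivity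
    linarith

end Algebra

/-- For all reals `a,b,c,d,f,g,h` with `h ≠ 0`, the metric Lie
algebra on `ℝ⁵` (standard orthonormal basis `E_1,…,E_5`) with nonzero brackets
`[E_1,E_2] = aE_3 + bE_4 + cE_5`, `[E_1,E_3] = dE_4 + fE_5`, `[E_1,E_4] = gE_5`,
`[E_2,E_3] = hE_5` satisfies the Jacobi identity and is not weakly Einstein. -/
theorem five_dim_nilpotent_family_not_weaklyEinstein
    (a b c d f g h : ℝ) (hh : h ≠ 0)
    (br : EuclideanSpace ℝ (Fin 5) → EuclideanSpace ℝ (Fin 5) → EuclideanSpace ℝ (Fin 5))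
    (hbr : ∀ x y : EuclideanSpace ℝ (Fin 5),
      br x y = ![0, 0,
        a * (x 0 * y 1 - x 1 * y 0),
        b * (x 0 * y 1 - x 1 * y 0) + d * (x 0 * y 2 - x 2 * y 0),
        c * (x 0 * y 1 - x 1 * y 0) + f * (x 0 * y 2 - x 2 * y 0)
          + g * (x 0 * y 3 - x 3 * y 0) + h * (x 1 * y 2 - x 2 * y 1)])
    (nab : EuclideanSpace ℝ (Fin 5) → EuclideanSpace ℝ (Fin 5) → EuclideanSpace ℝ (Fin 5))
    (hnab : IsLeviCivita br nab) :
    IsLieBracket br ∧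
      ¬ WeaklyEinstein br nab (EuclideanSpace.basisFun (Fin 5) ℝ) := by
  refine ⟨⟨fun X Y Z ↦ ?_, fun r X Y ↦ ?_, fun X Y ↦ ?_, fun X Y Z ↦ ?_⟩, fun hW ↦ ?_⟩
  · ext k
    fin_cases k <;> simp [hbr] <;> ring
  · ext k
    fin_cases k <;> simp [hbr] <;> ring
  · ext k
    fin_cases k <;> simp [hbr] <;> ring
  · ext k
    fin_cases k <;> simp [hbr] <;> ring
  have off (i j : Fin 5) (hij : i ≠ j) :
      ∑ k, curvEntries a b c d f g h i k ⬝ᵥ curvEntries a b c d f g h j k = 0 := by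
    have := hW (EuclideanSpace.basisFun (Fin 5) ℝ i) (EuclideanSpace.basisFun (Fin 5) ℝ j)
    rw [checkR_basisFun hbr hnab, OrthonormalBasis.inner_eq_zero _ hij] at this
    linarith
  have diag (i j : Fin 5) :
      ∑ k, curvEntries a b c d f g h i k ⬝ᵥ curvEntries a b c d f g h i k =
        ∑ k, curvEntries a b c d f g h j k ⬝ᵥ curvEntries a b c d f g h j k := by
    have hi := hW (EuclideanSpace.basisFun (Fin 5) ℝ i) (EuclideanSpace.basisFun (Fin 5) ℝ i)
    have hj := hW (EuclideanSpace.basisFun (Fin 5) ℝ j) (EuclideanSpace.basisFun (Fin 5) ℝ j)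
    rw [checkR_basisFun hbr hnab, OrthonormalBasis.inner_eq_one] at hi hj
    linarith
  have e12 := off 0 1 (by decide)
  have e13 := off 0 2 (by decide)
  have e14 := off 0 3 (by decide)
  have e15 := off 0 4 (by decide)
  have e23 := off 1 2 (by decide)
  have e24 := off 1 3 (by decide)
  have e25 := off 1 4 (by decide)
  have e35 := off 2 4 (by decide)
  have e45 := off 3 4 (by decide)
  have d25 := diag 1 4
  have d35 := diag 2 4
  have d45 := diag 3 4
  clear hW off diag hbr hnab
  simp only [Fin.sum_univ_five, curvEntries, upperCurvEntries]
    at e12 e13 e14 e15 e23 e24 e25 e35 e45 d25 d35 d45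
  simp at e12 e13 e14 e15 e23 e24 e25 e35 e45 d25 d35 d45
  rcases eq_or_ne a 0 with rfl | ha
  · refine false_of_curvature_eqs_of_eq_zero (b := b) (c := c) (d := d) (f := f) (g := g) hh
      (mul_left_cancel₀ hh ?_) (mul_left_cancel₀ hh ?_) ?_ ?_ ?_ ?_ ?_ ?_
    · linear_combination e12 / 2
    · linear_combination e13 / 2
    · linear_combination e25 / 2
    · linear_combination e35 / 2
    · linear_combination e45 / 2
    · linear_combination d25 / 2
    · linear_combination d35 / 2
    · linear_combination d45 / 2
  · have hah := mul_ne_zero ha hh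
    refine false_of_curvature_eqs_of_ne_zero (b := b) (c := c) (d := d) (f := f) (g := g) hh ha
      (mul_left_cancel₀ hh ?_) (mul_left_cancel₀ hh ?_) (mul_left_cancel₀ hah ?_)
      (mul_left_cancel₀ hah ?_) ?_ ?_ ?_ ?_
    · linear_combination e12 / 2
    · linear_combination e13 / 2
    · linear_combination e14 / 2
    · linear_combination e15 / 2
    · linear_combination e23 / 2
    · linear_combination e24 / 2
    · linear_combination e35 / 2
    · linear_combination d35 / 2
end
end
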